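/- arXiv:2301.07000 — 2 statements merged into one kernel-verified Lean document; each statement's English description precedes it below -/
import Mathlib

section
/- The Nehari set 𝒩^{φ_n} is nonempty. -/
open MeasureTheory Filter Topology Real
open scoped RealInnerProductSpace ENNReal NNReal

noncomputable section

/-- Euclidean space `ℝ^N`, identified with `ℂ × ℝ^{N-2}` via the first two coordinates. -/
abbrev E (N : ℕ) := EuclideanSpace ℝ (Fin N)

/-- The linear isometry of `ℝ^N ≡ ℂ × ℝ^{N-2}` given by `(z,y) ↦ (e^{iα} z, θ y)`:
rotation by the angle `α` in the first two coordinates together with a linear isometry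
`θ ∈ O(N-2)` acting on the remaining coordinates. -/
def act (N : ℕ) (hN : 2 ≤ N) (α : ℝ)
    (θ : EuclideanSpace ℝ (Fin (N - 2)) ≃ₗᵢ[ℝ] EuclideanSpace ℝ (Fin (N - 2)))
    (x : E N) : E N :=
  WithLp.toLp 2 fun i =>
    if h0 : (i : ℕ) = 0 then
      Real.cos α * x ⟨0, by omega⟩ - Real.sin α * x ⟨1, by omega⟩
    else if h1 : (i : ℕ) = 1 then
      Real.sin α * x ⟨0, by omega⟩ + Real.cos α * x ⟨1, by omega⟩
    else
      θ (WithLp.toLp 2 fun j : Fin (N - 2) => x ⟨(j : ℕ) + 2, by have := j.isLt; omega⟩)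
        ⟨(i : ℕ) - 2, by have := i.isLt; omega⟩

/-- The identity element of `O(N-2)`. -/
def idO (N : ℕ) : EuclideanSpace ℝ (Fin (N - 2)) ≃ₗᵢ[ℝ] EuclideanSpace ℝ (Fin (N - 2)) :=
  LinearIsometryEquiv.refl ℝ _

/-- The embedding `ℂ → ℂ × ℝ^{N-2} ≡ ℝ^N`, `w ↦ (w, 0)`. -/
def embedC (N : ℕ) (hN : 2 ≤ N) (w : ℂ) : E N :=
  WithLp.toLp 2 fun i => if (i : ℕ) = 0 then w.re else if (i : ℕ) = 1 then w.im else 0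

/-- Membership in the Sobolev space `H¹(ℝ^N)`. -/
def MemH1 (N : ℕ) (u : E N → ℝ) : Prop :=
  Differentiable ℝ u ∧ MemLp u 2 volume ∧ MemLp (fun x => gradient u x) 2 volume

/-- The squared norm `‖u‖_V² = ∫ (|∇u|² + V(x) u²)`. -/
def normVSq (N : ℕ) (V : E N → ℝ) (u : E N → ℝ) : ℝ :=
  ∫ x, (‖gradient u x‖ ^ 2 + V x * u x ^ 2)

/-- The squared `H¹`-distance between `u` and `v`. -/
def H1distSq (N : ℕ) (u v : E N → ℝ) : ℝ :=
  ∫ x, (‖gradient u x - gradient v x‖ ^ 2 + (u x - v x) ^ 2)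

/-- Strong convergence in `H¹(ℝ^N)`. -/
def TendstoH1 (N : ℕ) (u : ℕ → E N → ℝ) (v : E N → ℝ) : Prop :=
  Filter.Tendsto (fun k => H1distSq N (u k) v) Filter.atTop (nhds 0)

/-- Test functions: smooth with compact support. -/
def IsTest (N : ℕ) (v : E N → ℝ) : Prop := ContDiff ℝ (⊤ : ℕ∞) v ∧ HasCompactSupport v

/-- `u` is a (weak) solution of the competitive system
`-Δuᵢ + V uᵢ = |uᵢ|^{2p-2}uᵢ + β ∑_{j≠i} |u_j|^p |uᵢ|^{p-2} uᵢ`. -/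
def IsSolution (N ℓ : ℕ) (V : E N → ℝ) (β p : ℝ) (u : Fin ℓ → E N → ℝ) : Prop :=
  (∀ i, MemH1 N (u i)) ∧
  ∀ (i : Fin ℓ) (v : E N → ℝ), IsTest N v →
    ∫ x, (⟪gradient (u i) x, gradient v x⟫ + V x * u i x * v x) =
      ∫ x, (|u i x| ^ (2 * p - 2) * u i x * v x
        + β * (∑ j ∈ Finset.univ.erase i, |u j x| ^ p) * |u i x| ^ (p - 2) * u i x * v x)

/-- `u` is a (weak) solution of the single equation `-Δu + V u = c |u|^{2p-2} u`. -/
def IsEqSolution (N : ℕ) (V : E N → ℝ) (c p : ℝ) (u : E N → ℝ) : Prop :=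
  MemH1 N u ∧
  ∀ v : E N → ℝ, IsTest N v →
    ∫ x, (⟪gradient u x, gradient v x⟫ + V x * u x * v x) =
      c * ∫ x, |u x| ^ (2 * p - 2) * u x * v x

/-- The pinwheel symmetries: `u₁(e^{2πi/n} z, θ y) = u₁(z,y)` for every `θ ∈ O(N-2)`,
and `u_{j+1}(z,y) = u₁(e^{2πij/(ℓn)} z, y)`. -/
def Pinwheel (N : ℕ) (hN : 2 ≤ N) (n ℓ : ℕ) (hℓ : 0 < ℓ) (u : Fin ℓ → E N → ℝ) : Prop :=
  (∀ θ x, u ⟨0, hℓ⟩ (act N hN (2 * π / (n : ℝ)) θ x) = u ⟨0, hℓ⟩ x) ∧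
  (∀ (j : Fin ℓ) (x : E N),
    u j x = u ⟨0, hℓ⟩ (act N hN (2 * π * ((j : ℕ) : ℝ) / ((ℓ : ℝ) * (n : ℝ))) (idO N) x))

/-- `G_n`-invariance: `u(e^{2πi/n} z, θ y) = u(z,y)` for every `θ ∈ O(N-2)`. -/
def GInv (N : ℕ) (hN : 2 ≤ N) (n : ℕ) (u : E N → ℝ) : Prop :=
  ∀ θ x, u (act N hN (2 * π / (n : ℝ)) θ x) = u x

/-- `τ_n`-equivariance: `u(e^{πi/n} z, y) = -u(z,y)` and `u(z, θ y) = u(z,y)`. -/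
def TauInv (N : ℕ) (hN : 2 ≤ N) (n : ℕ) (u : E N → ℝ) : Prop :=
  (∀ x, u (act N hN (π / (n : ℝ)) (idO N) x) = -u x) ∧
  (∀ θ x, u (act N hN 0 θ x) = u x)

/-- A radial function. -/
def Radial (N : ℕ) (u : E N → ℝ) : Prop := ∀ x y : E N, ‖x‖ = ‖y‖ → u x = u y

/-- Hypothesis `(V₂)`: `0 < inf V` and `V(x) → V_∞ > 0` as `|x| → ∞`. -/
def HypV2 (N : ℕ) (V : E N → ℝ) (Vinf : ℝ) : Prop :=
  (∃ c > 0, ∀ x, c ≤ V x) ∧ 0 < Vinf ∧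
    Filter.Tendsto V (Filter.cocompact (E N)) (nhds Vinf)

/-- Hypothesis `(V₃ⁿ)`. -/
def HypV3 (N ℓ n : ℕ) (V : E N → ℝ) (Vinf : ℝ) : Prop :=
  ∃ C₀ > 0, ∃ R₀ > 0, ∃ lam : ℝ,
    0 < lam ∧ lam < 2 * Real.sin (π / ((ℓ : ℝ) * (n : ℝ))) ∧
    ∀ x : E N, R₀ ≤ ‖x‖ → V x ≤ Vinf - C₀ * Real.exp (-lam * Real.sqrt Vinf * ‖x‖)

/-- The energy functional `𝒥` of the system. -/
def energy (N ℓ : ℕ) (V : E N → ℝ) (β p : ℝ) (u : Fin ℓ → E N → ℝ) : ℝ :=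
  (1 / 2) * ∑ i, normVSq N V (u i)
    - (1 / (2 * p)) * ∑ i, ∫ x, |u i x| ^ (2 * p)
    - (β / (2 * p)) * ∑ i, ∑ j ∈ Finset.univ.erase i, ∫ x, |u i x| ^ p * |u j x| ^ p

/-- The energy functional `J` of a single equation. -/
def Jfun (N : ℕ) (V : E N → ℝ) (p : ℝ) (u : E N → ℝ) : ℝ :=
  (1 / 2) * normVSq N V u - (1 / (2 * p)) * ∫ x, |u x| ^ (2 * p)

/-- The derivative of `𝒥` at `u` in the direction `v`. -/
def dJ (N ℓ : ℕ) (V : E N → ℝ) (β p : ℝ) (u v : Fin ℓ → E N → ℝ) : ℝ :=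
  ∑ i, ((∫ x, (⟪gradient (u i) x, gradient (v i) x⟫ + V x * u i x * v i x))
    - (∫ x, |u i x| ^ (2 * p - 2) * u i x * v i x)
    - β * ∑ j ∈ Finset.univ.erase i, ∫ x, |u j x| ^ p * |u i x| ^ (p - 2) * u i x * v i x)

/-- The derivative of `Ψ(u) = 𝒥'(u)u` at `u` in the direction `v`. -/
def dPsi (N ℓ : ℕ) (V : E N → ℝ) (β p : ℝ) (u v : Fin ℓ → E N → ℝ) : ℝ :=
  ∑ i, (2 * (∫ x, (⟪gradient (u i) x, gradient (v i) x⟫ + V x * u i x * v i x))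
    - 2 * p * (∫ x, |u i x| ^ (2 * p - 2) * u i x * v i x)
    - 2 * p * β *
        ∑ j ∈ Finset.univ.erase i, ∫ x, |u j x| ^ p * |u i x| ^ (p - 2) * u i x * v i x)

/-- The Nehari set `𝒩^{φ_n}`. -/
def InNehari (N : ℕ) (hN : 2 ≤ N) (ℓ n : ℕ) (hℓ : 0 < ℓ) (V : E N → ℝ) (β p : ℝ)
    (u : Fin ℓ → E N → ℝ) : Prop :=
  (∀ i, MemH1 N (u i)) ∧ Pinwheel N hN n ℓ hℓ u ∧
  ∀ i, u i ≠ 0 ∧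
    normVSq N V (u i) =
      (∫ x, |u i x| ^ (2 * p)) +
        β * ∑ j ∈ Finset.univ.erase i, ∫ x, |u i x| ^ p * |u j x| ^ p

/-- `c^{φ_n} := inf_{𝒩^{φ_n}} 𝒥`. -/
def cPhi (N : ℕ) (hN : 2 ≤ N) (ℓ n : ℕ) (hℓ : 0 < ℓ) (V : E N → ℝ) (β p : ℝ) : ℝ :=
  sInf (energy N ℓ V β p '' {u | InNehari N hN ℓ n hℓ V β p u})

/-- The ground state energy `𝔠_∞` of the limit problem `-Δu + V_∞ u = |u|^{2p-2}u`. -/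
def cInfty (N : ℕ) (p Vinf : ℝ) : ℝ :=
  sInf (Jfun N (fun _ => Vinf) p ''
    {u | MemH1 N u ∧ u ≠ 0 ∧ normVSq N (fun _ => Vinf) u = ∫ x, |u x| ^ (2 * p)})

/-- The least energy `𝔠^{G_n}` on the `G_n`-invariant Nehari manifold. -/
def cGn (N : ℕ) (hN : 2 ≤ N) (n : ℕ) (V : E N → ℝ) (p : ℝ) : ℝ :=
  sInf (Jfun N V p ''
    {u | MemH1 N u ∧ u ≠ 0 ∧ GInv N hN n u ∧ normVSq N V u = ∫ x, |u x| ^ (2 * p)})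

/-- A least energy fully nontrivial (positive) solution of the system satisfying the
pinwheel symmetries. -/
def IsLeastEnergySol (N : ℕ) (hN : 2 ≤ N) (ℓ n : ℕ) (hℓ : 0 < ℓ) (V : E N → ℝ) (β p : ℝ)
    (u : Fin ℓ → E N → ℝ) : Prop :=
  IsSolution N ℓ V β p u ∧ (∀ i x, 0 < u i x) ∧ Pinwheel N hN n ℓ hℓ u ∧
  ∀ w, IsSolution N ℓ V β p w → (∀ i x, 0 < w i x) → Pinwheel N hN n ℓ hℓ w →
    energy N ℓ V β p u ≤ energy N ℓ V β p w

/-- The set `𝒲^n_ℓ` of weak `(n,ℓ)`-pinwheel partitions. -/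
def WeakPartition (N : ℕ) (hN : 2 ≤ N) (ℓ n : ℕ) (hℓ : 0 < ℓ) (V : E N → ℝ) (p : ℝ) :
    Set (Fin ℓ → E N → ℝ) :=
  {u | (∀ i, MemH1 N (u i)) ∧ Pinwheel N hN n ℓ hℓ u ∧
    (∀ i, u i ≠ 0 ∧ normVSq N V (u i) = ∫ x, |u i x| ^ (2 * p)) ∧
    ∀ i j, i ≠ j → ∀ x, u i x * u j x = 0}

/-- `ĉ^{φ_n} := inf_{𝒲^n_ℓ} (p-1)/(2p) ∑ ‖uᵢ‖_V²`. -/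
def hatC (N : ℕ) (hN : 2 ≤ N) (ℓ n : ℕ) (hℓ : 0 < ℓ) (V : E N → ℝ) (p : ℝ) : ℝ :=
  sInf ((fun u : Fin ℓ → E N → ℝ => (p - 1) / (2 * p) * ∑ i, normVSq N V (u i)) ''
    WeakPartition N hN ℓ n hℓ V p)

/-- The `G_n`-invariant Nehari set `𝓜_Ω` in `H¹₀(Ω)`. -/
def MOmega (N : ℕ) (hN : 2 ≤ N) (n : ℕ) (V : E N → ℝ) (p : ℝ) (Ω : Set (E N)) :
    Set (E N → ℝ) :=
  {u | MemH1 N u ∧ u ≠ 0 ∧ (∀ x ∉ Ω, u x = 0) ∧ GInv N hN n u ∧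
    normVSq N V u = ∫ x, |u x| ^ (2 * p)}

/-- `𝔠_Ω := inf_{𝓜_Ω} (p-1)/(2p) ‖u‖_V²`. -/
def cOmega (N : ℕ) (hN : 2 ≤ N) (n : ℕ) (V : E N → ℝ) (p : ℝ) (Ω : Set (E N)) : ℝ :=
  sInf ((fun u => (p - 1) / (2 * p) * normVSq N V u) '' MOmega N hN n V p Ω)

/-- An `(n,ℓ)`-pinwheel partition of `ℝ^N`. -/
def IsPinwheelPartition (N : ℕ) (hN : 2 ≤ N) (ℓ n : ℕ) (hℓ : 0 < ℓ)
    (Ω : Fin ℓ → Set (E N)) : Prop :=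
  (∀ j, (Ω j).Nonempty ∧ IsOpen (Ω j)) ∧
  (∀ i j, i ≠ j → Ω i ∩ Ω j = ∅) ∧
  (∀ j : Fin ℓ, Ω j =
    {x | act N hN (2 * π * ((j : ℕ) : ℝ) / ((ℓ : ℝ) * (n : ℝ))) (idO N) x ∈ Ω ⟨0, hℓ⟩}) ∧
  (∀ θ, ∀ x ∈ Ω ⟨0, hℓ⟩, act N hN (2 * π / (n : ℝ)) θ x ∈ Ω ⟨0, hℓ⟩)

/-- An optimal `(n,ℓ)`-pinwheel partition for the equation `-Δu + Vu = |u|^{2p-2}u`. -/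
def IsOptimalPinwheelPartition (N : ℕ) (hN : 2 ≤ N) (ℓ n : ℕ) (hℓ : 0 < ℓ)
    (V : E N → ℝ) (p : ℝ) (Ω : Fin ℓ → Set (E N)) : Prop :=
  IsPinwheelPartition N hN ℓ n hℓ Ω ∧
  (∀ j, ∃ u ∈ MOmega N hN n V p (Ω j),
    (p - 1) / (2 * p) * normVSq N V u = cOmega N hN n V p (Ω j)) ∧
  (∑ j, cOmega N hN n V p (Ω j)) =
    sInf {s | ∃ Θ : Fin ℓ → Set (E N), IsPinwheelPartition N hN ℓ n hℓ Θ ∧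
      s = ∑ j, cOmega N hN n V p (Θ j)}

/-- The Nehari manifold `𝓜^{τ_n}` of `τ_n`-equivariant functions. -/
def MTau (N : ℕ) (hN : 2 ≤ N) (n : ℕ) (V : E N → ℝ) (p : ℝ) : Set (E N → ℝ) :=
  {u | MemH1 N u ∧ u ≠ 0 ∧ TauInv N hN n u ∧ normVSq N V u = ∫ x, |u x| ^ (2 * p)}

/-- The sum of `n` truncated copies of `ω` placed at the vertices `R e^{2πij/n}` of a
regular `n`-gon in `ℂ × {0}`; the truncation radius is `ϱ R`. -/
def bumpSum (N : ℕ) (hN : 2 ≤ N) (n : ℕ) (ω χ : E N → ℝ) (ϱ R : ℝ) (x : E N) : ℝ :=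
  ∑ j ∈ Finset.range n,
    χ ((ϱ * R)⁻¹ •
        (x - R • embedC N hN (Complex.exp (((2 * π * (j : ℝ) / (n : ℝ) : ℝ) : ℂ) * Complex.I)))) *
      ω (x - R • embedC N hN (Complex.exp (((2 * π * (j : ℝ) / (n : ℝ) : ℝ) : ℂ) * Complex.I)))

/-- The test `ℓ`-tuple `w_R` built from translated truncations of `ω`, scaled by `t`. -/
def testTuple (N : ℕ) (hN : 2 ≤ N) (ℓ n : ℕ) (ω χ : E N → ℝ) (ϱ R t : ℝ) :
    Fin ℓ → E N → ℝ :=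
  fun i x => t * bumpSum N hN n ω χ ϱ R
    (act N hN (2 * π * ((i : ℕ) : ℝ) / ((ℓ : ℝ) * (n : ℝ))) (idO N) x)

end

noncomputable def zc (N : ℕ) (hN : 2 ≤ N) (x : E N) : ℂ :=
  ((x ⟨0, by omega⟩ : ℝ) : ℂ) + ((x ⟨1, by omega⟩ : ℝ) : ℂ) * Complex.I

noncomputable def yp (N : ℕ) (hN : 2 ≤ N) (x : E N) : EuclideanSpace ℝ (Fin (N - 2)) :=
  WithLp.toLp 2 fun j : Fin (N - 2) => x ⟨(j : ℕ) + 2, by have := j.isLt; omega⟩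

theorem zc_act (N : ℕ) (hN : 2 ≤ N) (α : ℝ) (θ) (x : E N) :
    zc N hN (act N hN α θ x) = Complex.exp (α * Complex.I) * zc N hN x := by
  rw [Complex.exp_mul_I, ← Complex.ofReal_cos, ← Complex.ofReal_sin]
  apply Complex.ext <;> simp [zc, act] <;> ring

theorem yp_act (N : ℕ) (hN : 2 ≤ N) (α : ℝ) (θ) (x : E N) :
    yp N hN (act N hN α θ x) = θ (yp N hN x) := by
  ext j
  simp [yp, act]

theorem norm_split (N : ℕ) (hN : 2 ≤ N) (x : E N) :
    ‖x‖ ^ 2 = ‖zc N hN x‖ ^ 2 + ‖yp N hN x‖ ^ 2 := by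
  obtain ⟨m, rfl⟩ := Nat.exists_eq_add_of_le' hN
  rw [EuclideanSpace.norm_sq_eq, EuclideanSpace.norm_sq_eq, Fin.sum_univ_succ, Fin.sum_univ_succ,
    ← add_assoc]
  congr 1
  rw [← Complex.normSq_eq_norm_sq, Complex.normSq_apply]
  simp [zc]
  ring_nf

theorem norm_act (N : ℕ) (hN : 2 ≤ N) (α : ℝ) (θ) (x : E N) :
    ‖act N hN α θ x‖ = ‖x‖ := by
  have h : ‖act N hN α θ x‖ ^ 2 = ‖x‖ ^ 2 := by
    rw [norm_split N hN, norm_split N hN x, zc_act, yp_act, norm_mul, Complex.norm_exp_ofReal_mul_I,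
      LinearIsometryEquiv.norm_map, one_mul]
  exact (sq_eq_sq₀ (norm_nonneg _) (norm_nonneg _)).1 h

/-- The action as a linear isometry. -/
noncomputable def actL (N : ℕ) (hN : 2 ≤ N) (α : ℝ) : E N ≃ₗᵢ[ℝ] E N :=
  LinearIsometry.toLinearIsometryEquiv
    { toFun := act N hN α (idO N)
      map_add' := by
        intro x y
        ext i
        simp only [act, idO, LinearIsometryEquiv.coe_refl, id, PiLp.add_apply]
        split_ifs <;> ring
      map_smul' := by
        intro c x
        ext i
        simp only [act, idO, LinearIsometryEquiv.coe_refl, id, PiLp.smul_apply, smul_eq_mul,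
          RingHom.id_apply]
        split_ifs <;> ring
      norm_map' := norm_act N hN α (idO N) } rfl

theorem actL_apply (N : ℕ) (hN : 2 ≤ N) (α : ℝ) (x : E N) :
    actL N hN α x = act N hN α (idO N) x := rfl

theorem norm_gradient_eq (N : ℕ) (u : E N → ℝ) (x : E N) :
    ‖gradient u x‖ = ‖fderiv ℝ u x‖ := by
  simp [gradient]

theorem memH1_of (N : ℕ) (u : E N → ℝ) (h : ContDiff ℝ 1 u) (hc : HasCompactSupport u) :
    MemH1 N u := by
  refine ⟨h.differentiable (by norm_num), h.continuous.memLp_of_hasCompactSupport hc, ?_⟩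
  apply Continuous.memLp_of_hasCompactSupport
  · exact (LinearIsometryEquiv.continuous _).comp (h.continuous_fderiv (by norm_num))
  · exact (hc.fderiv (𝕜 := ℝ)).comp_left (map_zero _)

theorem int_comp (N : ℕ) (L : E N ≃ₗᵢ[ℝ] E N) (F : E N → ℝ) :
    ∫ x, F (L x) = ∫ x, F x :=
  L.measurePreserving.integral_comp' (f := L.toMeasurableEquiv) F

theorem normVSq_comp (N : ℕ) (V u : E N → ℝ) (hV : Radial N V) (L : E N ≃ₗᵢ[ℝ] E N) :
    normVSq N V (fun x => u (L x)) = normVSq N V u := by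
  unfold normVSq
  rw [← int_comp N L (fun x => ‖gradient u x‖ ^ 2 + V x * u x ^ 2)]
  congr 1
  ext x
  have h1 : ‖gradient (fun x => u (L x)) x‖ = ‖gradient u (L x)‖ := by
    rw [norm_gradient_eq, norm_gradient_eq]
    have := L.toContinuousLinearEquiv.comp_right_fderiv (f := u) (x := x)
    have e : (fun x => u (L x)) = u ∘ L.toContinuousLinearEquiv := rfl
    rw [e, this]
    exact ContinuousLinearMap.opNorm_comp_linearIsometryEquiv _ L
  have h2 : V (L x) = V x := hV _ _ (L.norm_map x)
  simp [h1, h2]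

theorem normVSq_smul (N : ℕ) (V u : E N → ℝ) (t : ℝ) (h : Differentiable ℝ u) :
    normVSq N V (fun x => t * u x) = t ^ 2 * normVSq N V u := by
  unfold normVSq
  rw [← integral_const_mul]
  congr 1
  ext x
  rw [norm_gradient_eq, norm_gradient_eq, fderiv_const_mul (h x), norm_smul, mul_pow,
    Real.norm_eq_abs, sq_abs]
  ring

theorem normVSq_pos (N : ℕ) (V u : E N → ℝ) (hVc : Continuous V) (hV : ∀ x, 0 < V x)
    (h : ContDiff ℝ 1 u) (hc : HasCompactSupport u) (x₀ : E N) (hx : u x₀ ≠ 0) :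
    0 < normVSq N V u := by
  unfold normVSq
  simp only [norm_gradient_eq]
  have hf := h.continuous_fderiv (by norm_num)
  have hu := h.continuous
  refine Continuous.integral_pos_of_hasCompactSupport_nonneg_nonzero (x := x₀) (by fun_prop)
    ?_ ?_ ?_
  · apply HasCompactSupport.add
    · exact (hc.fderiv (𝕜 := ℝ)).comp_left (g := fun y => ‖y‖ ^ 2) (by simp)
    · exact HasCompactSupport.mul_left (hc.comp_left (g := fun y : ℝ => y ^ 2) (by simp))
  · intro x
    have := hV x
    positivity
  · have := hV x₀
    positivity

theorem pow_pos' (N : ℕ) (p : ℝ) (hp : 1 < p) (u : E N → ℝ)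
    (hu : Continuous u) (hc : HasCompactSupport u) (x₀ : E N) (hx : u x₀ ≠ 0) :
    0 < ∫ x, |u x| ^ (2 * p) := by
  refine Continuous.integral_pos_of_hasCompactSupport_nonneg_nonzero (x := x₀) ?_
    ?_ ?_ ?_
  · exact hu.abs.rpow_const (fun x => Or.inr (by linarith))
  · exact hc.comp_left (g := fun y : ℝ => |y| ^ (2 * p))
      (by simp; rw [Real.zero_rpow (by linarith)])
  · intro x
    positivity
  · positivity

theorem exists_profile (N : ℕ) (hN : 2 ≤ N) (ℓ n : ℕ) (hℓ : 2 ≤ ℓ) (hn : 1 ≤ n) :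
    ∃ w : E N → ℝ, ContDiff ℝ 1 w ∧ HasCompactSupport w ∧ (∃ x, w x ≠ 0) ∧
      (∀ θ x, w (act N hN (2 * π / (n : ℝ)) θ x) = w x) ∧
      (∀ i j : Fin ℓ, i ≠ j → ∀ x,
        w (act N hN (2 * π * ((i : ℕ) : ℝ) / ((ℓ : ℝ) * (n : ℝ))) (idO N) x) = 0 ∨
        w (act N hN (2 * π * ((j : ℕ) : ℝ) / ((ℓ : ℝ) * (n : ℝ))) (idO N) x) = 0) := by
  have hn0 : (n : ℂ) ≠ 0 := by exact_mod_cast (by omega : n ≠ 0)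
  have hl0 : (ℓ : ℂ) ≠ 0 := by exact_mod_cast (by omega : ℓ ≠ 0)
  set ω : ℂ := Complex.exp (2 * π * Complex.I / ℓ) with hω
  have hprim : IsPrimitiveRoot ω ℓ := Complex.isPrimitiveRoot_exp ℓ (by omega)
  obtain ⟨r, hr0, hr1, hr⟩ : ∃ r : ℝ, 0 < r ∧ r < 1 / 2 ∧
      ∀ i j : Fin ℓ, i ≠ j → 4 * r < ‖ω ^ (i : ℕ) - ω ^ (j : ℕ)‖ := by
    have h1 : ∀ᶠ r : ℝ in 𝓝[>] 0, 0 < r := self_mem_nhdsWithin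
    have h2 : ∀ᶠ r : ℝ in 𝓝[>] 0, r < 1 / 2 :=
      nhdsWithin_le_nhds (Iio_mem_nhds (by norm_num))
    have h3 : ∀ᶠ r : ℝ in 𝓝[>] 0, ∀ i j : Fin ℓ, i ≠ j → 4 * r < ‖ω ^ (i : ℕ) - ω ^ (j : ℕ)‖ := by
      rw [eventually_all]; intro i
      rw [eventually_all]; intro j
      by_cases hij : i = j
      · simp [hij]
      have : 0 < ‖ω ^ (i : ℕ) - ω ^ (j : ℕ)‖ := by
        rw [norm_pos_iff, sub_ne_zero]
        intro h
        exact hij (Fin.ext (hprim.pow_inj i.2 j.2 h))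
      have h4 : ∀ᶠ r : ℝ in 𝓝[>] 0, r < ‖ω ^ (i : ℕ) - ω ^ (j : ℕ)‖ / 4 :=
        nhdsWithin_le_nhds (Iio_mem_nhds (by positivity))
      filter_upwards [h4] with r hr _
      linarith
    exact (h1.and (h2.and h3)).exists
  let f : ContDiffBump (1 : ℂ) := ⟨r / 2, r, by positivity, by linarith⟩
  let g : ContDiffBump (0 : ℝ) := ⟨1, 2, by norm_num, by norm_num⟩
  have key : ∀ x : E N, f (zc N hN x ^ n) * g (‖yp N hN x‖ ^ 2) ≠ 0 →
      ‖zc N hN x ^ n - 1‖ < r ∧ ‖yp N hN x‖ ^ 2 < 2 := by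
    intro x hx
    have h1 : zc N hN x ^ n ∈ Function.support f := left_ne_zero_of_mul hx
    have h2 : ‖yp N hN x‖ ^ 2 ∈ Function.support g := right_ne_zero_of_mul hx
    rw [f.support_eq, mem_ball_iff_norm] at h1
    rw [g.support_eq, mem_ball_iff_norm, sub_zero, Real.norm_eq_abs, abs_of_nonneg (by positivity)]
      at h2
    exact ⟨h1, h2⟩
  refine ⟨fun x => f (zc N hN x ^ n) * g (‖yp N hN x‖ ^ 2), ?_, ?_, ?_, ?_, ?_⟩
  · have hz : ContDiff ℝ 1 (zc N hN) := by
      unfold zc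
      refine ContDiff.add ?_ (ContDiff.mul ?_ contDiff_const)
      · exact Complex.ofRealCLM.contDiff.comp
          (EuclideanSpace.proj (𝕜 := ℝ) (⟨0, by omega⟩ : Fin N)).contDiff
      · exact Complex.ofRealCLM.contDiff.comp
          (EuclideanSpace.proj (𝕜 := ℝ) (⟨1, by omega⟩ : Fin N)).contDiff
    have hy : ContDiff ℝ 1 (fun x => ‖yp N hN x‖ ^ 2) := by
      simp only [EuclideanSpace.norm_sq_eq, yp, Real.norm_eq_abs, sq_abs]
      refine ContDiff.sum fun j _ => ContDiff.pow ?_ 2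
      exact (EuclideanSpace.proj (𝕜 := ℝ) (⟨(j : ℕ) + 2, _⟩ : Fin N)).contDiff
    exact (f.contDiff.comp (hz.pow n)).mul (g.contDiff.comp hy)
  · refine HasCompactSupport.intro (isCompact_closedBall (0 : E N) 3) ?_
    intro x hx
    by_contra h
    obtain ⟨h1, h2⟩ := key x h
    apply hx
    rw [mem_closedBall_zero_iff]
    have h3 : ‖zc N hN x‖ ^ n < 2 := by
      rw [← norm_pow]
      have := norm_sub_norm_le (zc N hN x ^ n) 1
      rw [norm_one] at this
      linarith
    have h4 : ‖zc N hN x‖ < 2 := by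
      by_contra h5
      push Not at h5
      have := le_self_pow₀ (a := ‖zc N hN x‖) (by linarith) (by omega : n ≠ 0)
      linarith
    have h5 := norm_split N hN x
    nlinarith [norm_nonneg x, norm_nonneg (zc N hN x)]
  · refine ⟨embedC N hN 1, ?_⟩
    have h1 : zc N hN (embedC N hN 1) = 1 := by simp [zc, embedC]
    have h2 : yp N hN (embedC N hN 1) = 0 := by
      ext j; simp [yp, embedC]
    have h3 : f 1 = 1 := f.one_of_mem_closedBall (by simp [f]; positivity)
    have h4 : g 0 = 1 := g.one_of_mem_closedBall (by simp [g])
    simp [h1, h2, h3, h4]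
  · intro θ x
    simp only [zc_act, yp_act, LinearIsometryEquiv.norm_map, mul_pow]
    rw [← Complex.exp_nat_mul]
    have : (n : ℂ) * (((2 * π / (n : ℝ) : ℝ) : ℂ) * Complex.I) = 2 * π * Complex.I := by
      push_cast
      field_simp
    rw [this, Complex.exp_two_pi_mul_I, one_mul]
  · intro i j hij x
    have hpow : ∀ k : Fin ℓ, zc N hN (act N hN (2 * π * ((k : ℕ) : ℝ) / ((ℓ : ℝ) * (n : ℝ)))
        (idO N) x) ^ n = ω ^ (k : ℕ) * zc N hN x ^ n := by
      intro k
      rw [zc_act, mul_pow, ← Complex.exp_nat_mul, hω, ← Complex.exp_nat_mul]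
      congr 2
      push_cast
      field_simp
    have hnorm : ∀ k : Fin ℓ, ‖ω ^ (k : ℕ)‖ = 1 := by
      intro k
      rw [norm_pow, hprim.norm'_eq_one (by omega), one_pow]
    by_contra hcon
    push Not at hcon
    have hi := (key _ hcon.1).1
    have hj := (key _ hcon.2).1
    rw [hpow] at hi hj
    have h1 := norm_sub_le (ω ^ (i : ℕ) * zc N hN x ^ n - 1) (ω ^ (j : ℕ) * zc N hN x ^ n - 1)
    rw [sub_sub_sub_cancel_right, ← sub_mul, norm_mul] at h1
    have h2 := norm_sub_norm_le 1 (ω ^ (i : ℕ) * zc N hN x ^ n)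
    rw [norm_sub_rev, norm_mul, hnorm, one_mul, norm_one] at h2
    have h3 := hr i j hij
    nlinarith

/-- **Proposition 3.1(a)**: the Nehari set `𝒩^{φ_n}` is nonempty. -/
theorem statement8 (N ℓ n : ℕ) (hN : 4 ≤ N) (hℓ : 2 ≤ ℓ) (hn : 1 ≤ n)
    (p β : ℝ) (hp : 1 < p) (hp' : p < (N : ℝ) / ((N : ℝ) - 2)) (hβ : β < 0)
    (V : E N → ℝ) (Vinf : ℝ) (hVcont : Continuous V)
    (hV1 : Radial N V) (hV2 : HypV2 N V Vinf) :
    ∃ u : Fin ℓ → E N → ℝ, InNehari N (by omega) ℓ n (by omega) V β p u := by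
  have hN2 : 2 ≤ N := by omega
  obtain ⟨⟨c, hc0, hcV⟩, -, -⟩ := hV2
  obtain ⟨w, hw, hwc, ⟨x₀, hx₀⟩, hinv, hdisj⟩ := exists_profile N hN2 ℓ n hℓ hn
  have hA := normVSq_pos N V w hVcont (fun x => lt_of_lt_of_le hc0 (hcV x)) hw hwc x₀ hx₀
  have hB := pow_pos' N p hp w hw.continuous hwc x₀ hx₀
  set A := normVSq N V w with hAdef
  set B := ∫ x, |w x| ^ (2 * p) with hBdef
  set t : ℝ := (A / B) ^ (1 / (2 * p - 2)) with ht
  have ht0 : 0 < t := by positivity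
  have htp : t ^ (2 * p) * B = t ^ 2 * A := by
    have h1 : t ^ (2 * p - 2) = A / B := by
      rw [ht, ← Real.rpow_mul (by positivity), one_div, inv_mul_cancel₀ (by linarith),
        Real.rpow_one]
    have h2 : t ^ (2 * p) = t ^ 2 * t ^ (2 * p - 2) := by
      rw [← Real.rpow_natCast, ← Real.rpow_add ht0]
      congr 1
      push_cast
      ring
    rw [h2, h1]
    field_simp
  let L : Fin ℓ → E N ≃ₗᵢ[ℝ] E N := fun i =>
    actL N hN2 (2 * π * ((i : ℕ) : ℝ) / ((ℓ : ℝ) * (n : ℝ)))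
  have hwL : ∀ i, ContDiff ℝ 1 (fun x => w (L i x)) := fun i => hw.comp (L i).contDiff
  have hact0 : ∀ x : E N, act N hN2 (2 * π * (((0 : ℕ) : ℕ) : ℝ) / ((ℓ : ℝ) * (n : ℝ))) (idO N) x
      = x := by
    intro x
    ext i
    by_cases h0 : (i : ℕ) = 0
    · have : i = ⟨0, by omega⟩ := Fin.ext h0
      rw [this]
      simp [act]
    by_cases h1 : (i : ℕ) = 1
    · have : i = ⟨1, by omega⟩ := Fin.ext h1
      rw [this]
      simp [act]
    · have : (i : ℕ) - 2 + 2 = i := by omega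
      simp [act, h0, h1, idO, this]
  refine ⟨fun i x => t * w (L i x), ?_, ⟨?_, ?_⟩, ?_⟩
  · intro i
    refine memH1_of N _ (contDiff_const.mul (hwL i)) ?_
    exact HasCompactSupport.mul_left (hwc.comp_homeomorph (L i).toHomeomorph)
  · intro θ x
    simp only [L, actL_apply, hact0, hinv]
  · intro j x
    simp only [L, actL_apply, hact0]
  · intro i
    constructor
    · intro h
      have := congrFun h ((L i).symm x₀)
      simp [hx₀, ht0.ne'] at this
    · rw [normVSq_smul N V _ t ((hwL i).differentiable (by norm_num)), normVSq_comp N V w hV1 (L i)]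
      have e1 : ∫ x, |t * w (L i x)| ^ (2 * p) = t ^ (2 * p) * B := by
        rw [hBdef, ← int_comp N (L i) (fun x => |w x| ^ (2 * p)),
          ← integral_const_mul]
        congr 1
        ext x
        rw [abs_mul, abs_of_pos ht0, Real.mul_rpow ht0.le (abs_nonneg _)]
      have e2 : ∀ j ∈ Finset.univ.erase i,
          ∫ x, |t * w (L i x)| ^ p * |t * w (L j x)| ^ p = 0 := by
        intro j hj
        rw [Finset.mem_erase] at hj
        have : ∀ x, |t * w (L i x)| ^ p * |t * w (L j x)| ^ p = 0 := by
          intro x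
          have hp0 : p ≠ 0 := by linarith
          rcases hdisj i j hj.1.symm x with h | h
          · simp [L, actL_apply, h, Real.zero_rpow hp0]
          · simp [L, actL_apply, h, Real.zero_rpow hp0]
        simp only [this, integral_zero]
      rw [e1, Finset.sum_eq_zero e2, mul_zero, add_zero, htp]
end

section
/- c^{φ_n} ≤ ℓ·n·𝔠_∞, where c^{φ_n} := inf_{u ∈ 𝒩^{φ_n}} 𝒥(u) and 𝔠_∞ is the ground state energy of the limit equation −Δu + V_∞u = |u|^{2p−2}u in H¹(ℝ^N). -/
open MeasureTheory Filter Topology Real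
open scoped RealInnerProductSpace ENNReal NNReal

/-- reflection in the affine hyperplane `⟪e,x⟫ = c`. -/
noncomputable def sig {N : ℕ} (e : E N) (c : ℝ) (x : E N) : E N := x - (2 * (⟪e, x⟫ - c)) • e

/-- polarization. -/
noncomputable def pol {N : ℕ} (e : E N) (c : ℝ) (v : E N → ℝ) (x : E N) : ℝ :=
  if ⟪e, x⟫ ≤ c then max (v x) (v (sig e c x)) else min (v x) (v (sig e c x))

lemma inner_sig {N : ℕ} {e : E N} (he : ‖e‖ = 1) (c : ℝ) (x : E N) :
    ⟪e, sig e c x⟫ = 2 * c - ⟪e, x⟫ := by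
  unfold sig
  rw [inner_sub_right, inner_smul_right, real_inner_self_eq_norm_sq, he]; ring

lemma sig_sig {N : ℕ} {e : E N} (he : ‖e‖ = 1) (c : ℝ) (x : E N) :
    sig e c (sig e c x) = x := by
  have h := inner_sig he c x
  rw [sig, h]
  unfold sig
  rw [sub_sub, ← add_smul]
  have : 2 * (⟪e, x⟫ - c) + 2 * (2 * c - ⟪e, x⟫ - c) = 0 := by ring
  rw [this, zero_smul, sub_zero]

lemma normsq_sub_sig {N : ℕ} {e : E N} (he : ‖e‖ = 1) (c : ℝ) (x y : E N) :
    ‖x - sig e c y‖ ^ 2 = ‖x - y‖ ^ 2 + 4 * (⟪e, x⟫ - c) * (⟪e, y⟫ - c) := by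
  unfold sig
  have : x - (y - (2 * (⟪e, y⟫ - c)) • e) = (x - y) + (2 * (⟪e, y⟫ - c)) • e := by abel
  rw [this, norm_add_sq_real, inner_smul_right, norm_smul, he, inner_sub_left,
    real_inner_comm e x, real_inner_comm e y, mul_one, Real.norm_eq_abs, sq_abs]; ring

lemma normsq_sig {N : ℕ} {e : E N} (he : ‖e‖ = 1) (c : ℝ) (x : E N) :
    ‖sig e c x‖ ^ 2 = ‖x‖ ^ 2 - 4 * (⟪e, x⟫ - c) * c := by
  have := normsq_sub_sig he c 0 x
  simp only [zero_sub, norm_neg, inner_zero_right] at this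
  rw [this]; ring

lemma norm_sig_sub_sig {N : ℕ} {e : E N} (he : ‖e‖ = 1) (c : ℝ) (x y : E N) :
    ‖sig e c x - sig e c y‖ = ‖x - y‖ := by
  have h1 := normsq_sub_sig he c (sig e c x) y
  have h2 := normsq_sub_sig he c y x
  rw [inner_sig he, norm_sub_rev (sig e c x) y] at h1
  rw [norm_sub_rev y x] at h2
  have : ‖sig e c x - sig e c y‖ ^ 2 = ‖x - y‖ ^ 2 := by rw [h1, h2]; ring
  exact (sq_eq_sq₀ (norm_nonneg _) (norm_nonneg _)).1 this

lemma norm_sig_sub {N : ℕ} {e : E N} (he : ‖e‖ = 1) (c : ℝ) (x y : E N) :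
    ‖sig e c x - y‖ = ‖x - sig e c y‖ := by
  rw [← norm_sig_sub_sig he c (sig e c x) y, sig_sig he]

lemma continuous_sig {N : ℕ} (e : E N) (c : ℝ) : Continuous (sig e c) := by
  unfold sig; fun_prop

lemma mp_sig {N : ℕ} {e : E N} (he : ‖e‖ = 1) (c : ℝ) :
    MeasurePreserving (sig e c) (volume : Measure (E N)) volume := by
  have h1 := (Submodule.reflection (ℝ ∙ e)ᗮ).measurePreserving
  have h2 := measurePreserving_add_right (volume : Measure (E N)) ((2 * c) • e)
  have h3 := h2.comp h1
  have h4 : sig e c = (fun x => x + (2 * c) • e) ∘ (Submodule.reflection (ℝ ∙ e)ᗮ) := by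
   funext x
   simp only [Function.comp, Submodule.reflection_orthogonal_apply,
    Submodule.reflection_singleton_apply, he, sig]
   simp only [RCLike.ofReal_real_eq_id, id, one_pow, div_one, neg_sub]
   rw [two_smul, mul_sub, sub_smul, two_mul, add_smul]
   abel
  rw [h4]
  exact h3

lemma pol_cases {N : ℕ} {e : E N} (he : ‖e‖ = 1) (c : ℝ) (v : E N → ℝ) (x : E N) :
    (pol e c v x = v x ∧ pol e c v (sig e c x) = v (sig e c x)) ∨
    (pol e c v x = v (sig e c x) ∧ pol e c v (sig e c x) = v x) := by
  unfold pol
  rw [inner_sig he, sig_sig he]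
  rcases lt_trichotomy (⟪e, x⟫) c with h | h | h
  · rw [if_pos h.le, if_neg (by linarith)]
    rcases le_total (v x) (v (sig e c x)) with h' | h'
    · right; simp [h']
    · left; simp [h']
  · left
    have : sig e c x = x := by simp [sig, h]
    simp [this]
  · rw [if_neg (by linarith), if_pos (by linarith)]
    rcases le_total (v x) (v (sig e c x)) with h' | h'
    · left; simp [h']
    · right; simp [h']

lemma pol_on {N : ℕ} {e : E N} (he : ‖e‖ = 1) {c : ℝ} (v : E N → ℝ) {x : E N}
    (h : ⟪e, x⟫ ≤ c) : pol e c v x = max (v x) (v (sig e c x)) ∧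
      pol e c v (sig e c x) = min (v x) (v (sig e c x)) := by
  refine ⟨by simp [pol, h], ?_⟩
  unfold pol
  rw [inner_sig he, sig_sig he]
  rcases h.lt_or_eq with h | h
  · rw [if_neg (by linarith), min_comm]
  · have : sig e c x = x := by simp [sig, h]
    simp [this]

lemma pol_on' {N : ℕ} {e : E N} (he : ‖e‖ = 1) {c : ℝ} (v : E N → ℝ) {x : E N}
    (h : c ≤ ⟪e, x⟫) : pol e c v x = min (v x) (v (sig e c x)) ∧
      pol e c v (sig e c x) = max (v x) (v (sig e c x)) := by
  have := pol_on he v (x := sig e c x) (c := c) (by rw [inner_sig he]; linarith)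
  rw [sig_sig he] at this
  exact ⟨by rw [this.2, min_comm], by rw [this.1, max_comm]⟩

lemma pol_mod {N : ℕ} {e : E N} (he : ‖e‖ = 1) (c : ℝ) (v : E N → ℝ) {d ε : ℝ}
    (h : ∀ x y : E N, ‖x - y‖ ≤ d → |v x - v y| ≤ ε) (x y : E N) (hxy : ‖x - y‖ ≤ d) :
    |pol e c v x - pol e c v y| ≤ ε := by
  have h1 := h x y hxy
  have h2 := h (sig e c x) (sig e c y) (by rwa [norm_sig_sub_sig he])
  have key : ∀ z w : E N, ⟪e, z⟫ ≤ c → c ≤ ⟪e, w⟫ → ‖z - w‖ ≤ d → ‖z - sig e c w‖ ≤ d := by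
    intro z w hz hw hd
    refine le_trans ?_ hd
    apply le_of_sq_le_sq _ (norm_nonneg _)
    rw [normsq_sub_sig he]
    nlinarith
  rw [abs_le] at *
  rcases le_total (⟪e, x⟫) c with hx | hx <;> rcases le_total (⟪e, y⟫) c with hy | hy
  · rw [(pol_on he v hx).1, (pol_on he v hy).1]
    rcases max_cases (v x) (v (sig e c x)) with h3 | h3 <;>
    rcases max_cases (v y) (v (sig e c y)) with h4 | h4 <;> constructor <;> linarith
  · have h5 := abs_le.1 (h _ _ (key x y hx hy hxy))
    have h6 := abs_le.1 (h (sig e c x) y (by rw [norm_sig_sub he]; exact key x y hx hy hxy))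
    rw [(pol_on he v hx).1, (pol_on' he v hy).1]
    rcases max_cases (v x) (v (sig e c x)) with h3 | h3 <;>
    rcases min_cases (v y) (v (sig e c y)) with h4 | h4 <;> constructor <;> linarith
  · have h7 := key y x hy hx (by rwa [norm_sub_rev])
    have h5 := abs_le.1 (h y (sig e c x) h7)
    have h6 := abs_le.1 (h (sig e c y) x (by rwa [norm_sig_sub he]))
    rw [(pol_on' he v hx).1, (pol_on he v hy).1]
    rcases min_cases (v x) (v (sig e c x)) with h3 | h3 <;>
    rcases max_cases (v y) (v (sig e c y)) with h4 | h4 <;> constructor <;> linarith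
  · rw [(pol_on' he v hx).1, (pol_on' he v hy).1]
    rcases min_cases (v x) (v (sig e c x)) with h3 | h3 <;>
    rcases min_cases (v y) (v (sig e c y)) with h4 | h4 <;> constructor <;> linarith

/-- the kernel. -/
noncomputable def ker1 (h t : ℝ) : ℝ := if t < h then 1 else 0

lemma ker1_anti (h : ℝ) : Antitone (ker1 h) := by
  intro s t hst
  unfold ker1
  split_ifs <;> linarith

lemma ker1_nonneg (h t : ℝ) : 0 ≤ ker1 h t := by unfold ker1; split_ifs <;> norm_num

/-- nonlocal energy. -/
noncomputable def KE {N : ℕ} (h : ℝ) (v : E N → ℝ) : ℝ≥0∞ :=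
  ∫⁻ q : E N × E N, ENNReal.ofReal (ker1 h ‖q.1 - q.2‖ * (v q.1 - v q.2) ^ 2)
    ∂((volume : Measure (E N)).prod volume)

lemma four_point (k k' a a' b b' α α' γ γ' : ℝ)
    (ha : (α = a ∧ α' = a') ∨ (α = a' ∧ α' = a)) (hb : (γ = b ∧ γ' = b') ∨ (γ = b' ∧ γ' = b))
    (hk : 0 ≤ (k - k') * ((α * γ + α' * γ') - (a * b + a' * b'))) :
    k * (α - γ) ^ 2 + k * (α' - γ') ^ 2 + (k' * (α - γ') ^ 2 + k' * (α' - γ) ^ 2) ≤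
    k * (a - b) ^ 2 + k * (a' - b') ^ 2 + (k' * (a - b') ^ 2 + k' * (a' - b) ^ 2) := by
  rcases ha with ⟨rfl, rfl⟩ | ⟨rfl, rfl⟩ <;> rcases hb with ⟨rfl, rfl⟩ | ⟨rfl, rfl⟩ <;> nlinarith

lemma pol_four {N : ℕ} {e : E N} (he : ‖e‖ = 1) (c : ℝ) (v : E N → ℝ) (h : ℝ) (x y : E N) :
    ker1 h ‖x - y‖ * (pol e c v x - pol e c v y) ^ 2
     + ker1 h ‖sig e c x - sig e c y‖ * (pol e c v (sig e c x) - pol e c v (sig e c y)) ^ 2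
     + (ker1 h ‖x - sig e c y‖ * (pol e c v x - pol e c v (sig e c y)) ^ 2
     + ker1 h ‖sig e c x - y‖ * (pol e c v (sig e c x) - pol e c v y) ^ 2) ≤
    ker1 h ‖x - y‖ * (v x - v y) ^ 2
     + ker1 h ‖sig e c x - sig e c y‖ * (v (sig e c x) - v (sig e c y)) ^ 2
     + (ker1 h ‖x - sig e c y‖ * (v x - v (sig e c y)) ^ 2
     + ker1 h ‖sig e c x - y‖ * (v (sig e c x) - v y) ^ 2) := by
  rw [norm_sig_sub_sig he, norm_sig_sub he]
  apply four_point _ _ _ _ _ _ _ _ _ _ (pol_cases he c v x) (pol_cases he c v y)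
  have near : 0 ≤ (⟪e, x⟫ - c) * (⟪e, y⟫ - c) → ker1 h ‖x - sig e c y‖ ≤ ker1 h ‖x - y‖ := by
    intro hh
    apply ker1_anti
    apply le_of_sq_le_sq _ (norm_nonneg _)
    rw [normsq_sub_sig he]; linarith
  have far : (⟪e, x⟫ - c) * (⟪e, y⟫ - c) ≤ 0 → ker1 h ‖x - y‖ ≤ ker1 h ‖x - sig e c y‖ := by
    intro hh
    apply ker1_anti
    apply le_of_sq_le_sq _ (norm_nonneg _)
    rw [normsq_sub_sig he]; linarith
  rcases le_total (⟪e, x⟫) c with hx | hx <;> rcases le_total (⟪e, y⟫) c with hy | hy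
  · rw [(pol_on he v hx).1, (pol_on he v hy).1, (pol_on he v hx).2, (pol_on he v hy).2]
    apply mul_nonneg (sub_nonneg.2 (near (by nlinarith)))
    rcases le_total (v x) (v (sig e c x)) with h3 | h3 <;>
    rcases le_total (v y) (v (sig e c y)) with h4 | h4 <;> simp only [h3, h4, max_eq_left, max_eq_right, min_eq_left, min_eq_right] <;> nlinarith
  · rw [(pol_on he v hx).1, (pol_on' he v hy).1, (pol_on he v hx).2, (pol_on' he v hy).2]
    apply mul_nonneg_of_nonpos_of_nonpos (sub_nonpos.2 (far (by nlinarith)))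
    rcases le_total (v x) (v (sig e c x)) with h3 | h3 <;>
    rcases le_total (v y) (v (sig e c y)) with h4 | h4 <;> simp only [h3, h4, max_eq_left, max_eq_right, min_eq_left, min_eq_right] <;> nlinarith
  · rw [(pol_on' he v hx).1, (pol_on he v hy).1, (pol_on' he v hx).2, (pol_on he v hy).2]
    apply mul_nonneg_of_nonpos_of_nonpos (sub_nonpos.2 (far (by nlinarith)))
    rcases le_total (v x) (v (sig e c x)) with h3 | h3 <;>
    rcases le_total (v y) (v (sig e c y)) with h4 | h4 <;> simp only [h3, h4, max_eq_left, max_eq_right, min_eq_left, min_eq_right] <;> nlinarith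
  · rw [(pol_on' he v hx).1, (pol_on' he v hy).1, (pol_on' he v hx).2, (pol_on' he v hy).2]
    apply mul_nonneg (sub_nonneg.2 (near (by nlinarith)))
    rcases le_total (v x) (v (sig e c x)) with h3 | h3 <;>
    rcases le_total (v y) (v (sig e c y)) with h4 | h4 <;> simp only [h3, h4, max_eq_left, max_eq_right, min_eq_left, min_eq_right] <;> nlinarith

lemma measurable_ker1 (h : ℝ) : Measurable (ker1 h) := (ker1_anti h).measurable

lemma KE_meas {N : ℕ} (h : ℝ) {v : E N → ℝ} (hv : Measurable v) :
    Measurable (fun q : E N × E N =>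
      ENNReal.ofReal (ker1 h ‖q.1 - q.2‖ * (v q.1 - v q.2) ^ 2)) := by
  have := measurable_ker1 h
  have h1 : Measurable (fun q : E N × E N => ker1 h ‖q.1 - q.2‖) := this.comp (by fun_prop)
  fun_prop

lemma KE_four {N : ℕ} {e : E N} (he : ‖e‖ = 1) (c : ℝ) (h : ℝ) {v : E N → ℝ} (hv : Measurable v) :
    4 * KE h v = ∫⁻ q : E N × E N, ENNReal.ofReal
     (ker1 h ‖q.1 - q.2‖ * (v q.1 - v q.2) ^ 2
     + ker1 h ‖sig e c q.1 - sig e c q.2‖ * (v (sig e c q.1) - v (sig e c q.2)) ^ 2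
     + (ker1 h ‖q.1 - sig e c q.2‖ * (v q.1 - v (sig e c q.2)) ^ 2
     + ker1 h ‖sig e c q.1 - q.2‖ * (v (sig e c q.1) - v q.2) ^ 2))
     ∂((volume : Measure (E N)).prod volume) := by
  have hs := mp_sig he c
  have hid := MeasurePreserving.id (volume : Measure (E N))
  have m := KE_meas h hv
  have e1 := (hs.prod hs).lintegral_comp m
  have e2 := (hid.prod hs).lintegral_comp m
  have e3 := (hs.prod hid).lintegral_comp m
  have m1 := m.comp (hs.prod hs).measurable
  have m2 := m.comp (hid.prod hs).measurable
  have m3 := m.comp (hs.prod hid).measurable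
  simp only [Function.comp_def, Prod.map, id] at e1 e2 e3 m1 m2 m3
  have nn : ∀ a b, 0 ≤ ker1 h a * b ^ 2 := fun a b => mul_nonneg (ker1_nonneg _ _) (sq_nonneg _)
  have e4 : (4 : ℝ≥0∞) * KE h v = KE h v + KE h v + (KE h v + KE h v) := by
    rw [← two_mul, ← two_mul, ← mul_assoc]; norm_num
  have step : ∀ q : E N × E N, ENNReal.ofReal
     (ker1 h ‖q.1 - q.2‖ * (v q.1 - v q.2) ^ 2
     + ker1 h ‖sig e c q.1 - sig e c q.2‖ * (v (sig e c q.1) - v (sig e c q.2)) ^ 2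
     + (ker1 h ‖q.1 - sig e c q.2‖ * (v q.1 - v (sig e c q.2)) ^ 2
     + ker1 h ‖sig e c q.1 - q.2‖ * (v (sig e c q.1) - v q.2) ^ 2)) =
     ENNReal.ofReal (ker1 h ‖q.1 - q.2‖ * (v q.1 - v q.2) ^ 2)
     + ENNReal.ofReal (ker1 h ‖sig e c q.1 - sig e c q.2‖ * (v (sig e c q.1) - v (sig e c q.2)) ^ 2)
     + (ENNReal.ofReal (ker1 h ‖q.1 - sig e c q.2‖ * (v q.1 - v (sig e c q.2)) ^ 2)
     + ENNReal.ofReal (ker1 h ‖sig e c q.1 - q.2‖ * (v (sig e c q.1) - v q.2) ^ 2)) := by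
    intro q
    rw [ENNReal.ofReal_add (add_nonneg (nn _ _) (nn _ _)) (add_nonneg (nn _ _) (nn _ _)),
      ENNReal.ofReal_add (nn _ _) (nn _ _), ENNReal.ofReal_add (nn _ _) (nn _ _)]
  rw [lintegral_congr step, lintegral_add_left (by exact m.add m1), lintegral_add_left m,
    lintegral_add_left m2, e1, e2, e3, e4]
  rfl

lemma KE_pol {N : ℕ} {e : E N} (he : ‖e‖ = 1) (c : ℝ) (h : ℝ) {v : E N → ℝ} (hv : Measurable v)
    (hp : Measurable (pol e c v)) : KE h (pol e c v) ≤ KE h v := by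
  have h1 : 4 * KE h (pol e c v) ≤ 4 * KE h v := by
    rw [KE_four he c h hv, KE_four he c h hp]
    exact lintegral_mono fun q => ENNReal.ofReal_le_ofReal (pol_four he c v h q.1 q.2)
  exact (ENNReal.mul_le_mul_iff_right (by norm_num) (by norm_num)).1 h1

/-- the class of competitors. -/
structure PCls {N : ℕ} (u : E N → ℝ) (R : ℝ) (v : E N → ℝ) : Prop where
  nonneg : ∀ x, 0 ≤ v x
  bdd : ∀ M, (∀ x, u x ≤ M) → ∀ x, v x ≤ M
  supp : ∀ x, R < ‖x‖ → v x = 0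
  mod : ∀ d ε, (∀ x y, ‖x - y‖ ≤ d → |u x - u y| ≤ ε) → ∀ x y, ‖x - y‖ ≤ d → |v x - v y| ≤ ε
  int : ∀ F : ℝ → ℝ, Continuous F → F 0 = 0 → ∫ x, F (v x) = ∫ x, F (u x)
  ke : ∀ h, KE h v ≤ KE h u

lemma hcs_of_ball {N : ℕ} {f : E N → ℝ} {R : ℝ} (hs : ∀ x, R < ‖x‖ → f x = 0) :
    HasCompactSupport f := by
  apply HasCompactSupport.intro (isCompact_closedBall (0 : E N) R)
  intro x hx
  apply hs
  simpa [Metric.mem_closedBall] using hx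

lemma integrable_of_ball {N : ℕ} {f : E N → ℝ} {R : ℝ} (hc : Continuous f)
    (hs : ∀ x, R < ‖x‖ → f x = 0) : Integrable f :=
  hc.integrable_of_hasCompactSupport (hcs_of_ball hs)

lemma uc_of_ball {N : ℕ} {f : E N → ℝ} {R : ℝ} (hc : Continuous f)
    (hs : ∀ x, R < ‖x‖ → f x = 0) (ε : ℝ) (hε : 0 < ε) :
    ∃ d > 0, ∀ x y, ‖x - y‖ ≤ d → |f x - f y| ≤ ε := by
  have h := hc.uniformContinuous_of_tendsto_cocompact (x := 0) (by
    have := (hcs_of_ball hs)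
    exact (HasCompactSupport.is_zero_at_infty this))
  obtain ⟨d, hd, h⟩ := Metric.uniformContinuous_iff.1 h ε hε
  refine ⟨d / 2, by positivity, fun x y hxy => ?_⟩
  have := h (a := x) (b := y) (by rw [dist_eq_norm]; linarith)
  rw [Real.dist_eq] at this
  exact this.le

lemma cont_of_mod {N : ℕ} {u v : E N → ℝ} {R : ℝ} (hc : Continuous u)
    (hs : ∀ x, R < ‖x‖ → u x = 0)
    (mod : ∀ d ε, (∀ x y, ‖x - y‖ ≤ d → |u x - u y| ≤ ε) → ∀ x y, ‖x - y‖ ≤ d → |v x - v y| ≤ ε) :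
    Continuous v := by
  rw [Metric.continuous_iff]
  intro b ε hε
  obtain ⟨d, hd, h⟩ := uc_of_ball hc hs (ε / 2) (by positivity)
  refine ⟨d, hd, fun a ha => ?_⟩
  rw [dist_eq_norm] at ha
  have := mod d _ h a b ha.le
  rw [Real.dist_eq]; linarith

lemma bdd_of_ball {N : ℕ} {f : E N → ℝ} {R : ℝ} (hc : Continuous f)
    (hs : ∀ x, R < ‖x‖ → f x = 0) : ∃ M, ∀ x, |f x| ≤ M := by
  obtain ⟨M, hM⟩ := hc.bounded_above_of_compact_support (hcs_of_ball hs)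
  exact ⟨M, hM⟩

lemma pcls_pol {N : ℕ} {e : E N} (he : ‖e‖ = 1) {c : ℝ} (hc0 : 0 ≤ c) {u v : E N → ℝ} {R : ℝ}
    (hc : Continuous u) (hs : ∀ x, R < ‖x‖ → u x = 0) (hv : PCls u R v) :
    PCls u R (pol e c v) := by
  have vc : Continuous v := cont_of_mod hc hs hv.mod
  have hmod : ∀ d ε, (∀ x y, ‖x - y‖ ≤ d → |u x - u y| ≤ ε) → ∀ x y, ‖x - y‖ ≤ d →
      |pol e c v x - pol e c v y| ≤ ε := fun d ε h => pol_mod he c v (hv.mod d ε h)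
  have pc : Continuous (pol e c v) := cont_of_mod hc hs hmod
  have hsupp : ∀ x, R < ‖x‖ → pol e c v x = 0 := by
    intro x hx
    have h0 := hv.supp x hx
    rcases le_or_gt (⟪e, x⟫) c with h | h
    · rw [(pol_on he v h).1, h0, hv.supp, max_self]
      refine hx.trans_le ?_
      apply le_of_sq_le_sq _ (norm_nonneg _)
      rw [normsq_sig he]; nlinarith
    · rw [(pol_on' he v h.le).1, h0]
      exact min_eq_left (hv.nonneg _)
  refine ⟨fun x => ?_, fun M hM x => ?_, hsupp, hmod, fun F hF h0 => ?_, fun h =>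
    (KE_pol he c h vc.measurable pc.measurable).trans (hv.ke h)⟩
  · rcases pol_cases he c v x with h | h <;> rw [h.1] <;> exact hv.nonneg _
  · rcases pol_cases he c v x with h | h <;> rw [h.1] <;> exact hv.bdd M hM _
  · rw [← hv.int F hF h0]
    have i1 : Integrable (fun x => F (pol e c v x)) :=
      integrable_of_ball (hF.comp pc) (R := R) fun x hx => by rw [hsupp x hx, h0]
    have i2 : Integrable (fun x => F (v x)) :=
      integrable_of_ball (hF.comp vc) (R := R) fun x hx => by rw [hv.supp x hx, h0]
    have s := mp_sig he c
    have me : MeasurableEmbedding (sig e c) := by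
      refine (Homeomorph.mk ⟨sig e c, sig e c, sig_sig he c, sig_sig he c⟩
        (continuous_sig e c) (continuous_sig e c)).measurableEmbedding
    have j1 := s.integral_comp me (fun x => F (pol e c v x))
    have j2 := s.integral_comp me (fun x => F (v x))
    have k1 : Integrable (fun x => F (pol e c v (sig e c x))) := (s.integrable_comp i1.1).2 i1
    have k2 : Integrable (fun x => F (v (sig e c x))) := (s.integrable_comp i2.1).2 i2
    have : ∫ x, (F (pol e c v x) + F (pol e c v (sig e c x))) =
        ∫ x, (F (v x) + F (v (sig e c x))) := by
      congr 1; funext x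
      rcases pol_cases he c v x with h | h <;> rw [h.1, h.2]
      ring
    rw [integral_add i1 k1, integral_add i2 k2] at this
    linarith

lemma dct_ball {N : ℕ} (R M : ℝ) {fk : ℕ → E N → ℝ} {f : E N → ℝ} (hc : ∀ k, Continuous (fk k))
    (hs : ∀ k x, R < ‖x‖ → fk k x = 0) (hb : ∀ k x, |fk k x| ≤ M)
    (hl : ∀ x, Tendsto (fun k => fk k x) atTop (𝓝 (f x))) :
    Tendsto (fun k => ∫ x, fk k x) atTop (𝓝 (∫ x, f x)) := by
  apply tendsto_integral_of_dominated_convergence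
    ((Metric.closedBall (0 : E N) R).indicator fun _ => M)
  · exact fun k => (hc k).aestronglyMeasurable
  · rw [integrable_indicator_iff Metric.isClosed_closedBall.measurableSet]
    exact integrableOn_const (measure_closedBall_lt_top).ne
  · intro k
    refine Eventually.of_forall fun x => ?_
    by_cases hx : x ∈ Metric.closedBall (0 : E N) R
    · rw [Set.indicator_of_mem hx]; exact hb k x
    · rw [Set.indicator_of_notMem hx, hs k x (by simpa using hx)]; simp
  · exact Eventually.of_forall hl

lemma pcls_lim {N : ℕ} {u v : E N → ℝ} {R : ℝ} {vk : ℕ → E N → ℝ}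
    (hc : Continuous u) (hs : ∀ x, R < ‖x‖ → u x = 0) (hv : ∀ k, PCls u R (vk k))
    (hl : ∀ x, Tendsto (fun k => vk k x) atTop (𝓝 (v x))) : PCls u R v := by
  obtain ⟨M, hM⟩ := bdd_of_ball hc hs
  have hM0 : 0 ≤ M := (abs_nonneg _).trans (hM 0)
  have kc : ∀ k, Continuous (vk k) := fun k => cont_of_mod hc hs (hv k).mod
  refine ⟨fun x => ge_of_tendsto' (hl x) fun k => (hv k).nonneg x,
    fun M hM x => le_of_tendsto' (hl x) fun k => (hv k).bdd M hM x,
    fun x hx => ?_, fun d ε h x y hxy => ?_, fun F hF h0 => ?_, fun h => ?_⟩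
  · refine tendsto_nhds_unique (hl x) ?_
    simp_rw [fun k => (hv k).supp x hx]
    exact tendsto_const_nhds
  · exact le_of_tendsto' ((hl x).sub (hl y)).abs fun k => (hv k).mod d ε h x y hxy
  · obtain ⟨B, hB⟩ := (isCompact_Icc (a := (0:ℝ)) (b := M)).exists_bound_of_continuousOn hF.continuousOn
    have := dct_ball R B (fk := fun k x => F (vk k x)) (f := fun x => F (v x))
      (fun k => hF.comp (kc k)) (fun k x hx => by rw [(hv k).supp x hx, h0])
      (fun k x => hB _ ⟨(hv k).nonneg x, (hv k).bdd M (fun x => (le_abs_self _).trans (hM x)) x⟩)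
      (fun x => (hF.tendsto _).comp (hl x))
    simp_rw [fun k => (hv k).int F hF h0] at this
    exact tendsto_nhds_unique this tendsto_const_nhds
  · unfold KE
    calc _ ≤ ∫⁻ q : E N × E N, liminf (fun k => ENNReal.ofReal (ker1 h ‖q.1 - q.2‖ * (vk k q.1 - vk k q.2) ^ 2)) atTop
          ∂((volume : Measure (E N)).prod volume) := by
          apply lintegral_mono
          intro q
          refine le_of_eq (Tendsto.liminf_eq ?_).symm
          apply ENNReal.tendsto_ofReal
          exact (((hl q.1).sub (hl q.2)).pow 2).const_mul _
      _ ≤ liminf (fun k => KE h (vk k)) atTop := by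
          apply lintegral_liminf_le
          exact fun k => KE_meas h (kc k).measurable
      _ ≤ KE h u := by
          apply liminf_le_of_le
          · isBoundedDefault
          · intro b hb
            obtain ⟨k, hk⟩ := hb.exists
            exact hk.trans ((hv k).ke h)

lemma pcls_subseq {N : ℕ} {u : E N → ℝ} {R : ℝ} {vk : ℕ → E N → ℝ}
    (hc : Continuous u) (hs : ∀ x, R < ‖x‖ → u x = 0) (hv : ∀ k, PCls u R (vk k)) :
    ∃ φ : ℕ → ℕ, StrictMono φ ∧ ∃ v : E N → ℝ, ∀ x, Tendsto (fun k => vk (φ k) x) atTop (𝓝 (v x)) := by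
  classical
  obtain ⟨M, hM⟩ := bdd_of_ball hc hs
  have kc : ∀ k, Continuous (vk k) := fun k => cont_of_mod hc hs (hv k).mod
  have : CompactSpace (Metric.closedBall (0 : E N) R) :=
    isCompact_iff_compactSpace.1 (isCompact_closedBall _ _)
  let f : ℕ → BoundedContinuousFunction (Metric.closedBall (0 : E N) R) ℝ := fun k =>
    BoundedContinuousFunction.mkOfCompact ⟨fun x => vk k x, (kc k).comp continuous_subtype_val⟩
  have hcomp : IsCompact (closure (Set.range f)) := by
    apply BoundedContinuousFunction.arzela_ascoli (Set.Icc 0 M) isCompact_Icc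
    · rintro _ x ⟨k, rfl⟩
      exact ⟨(hv k).nonneg x, (hv k).bdd M (fun x => (le_abs_self _).trans (hM x)) x⟩
    · intro x
      rw [Metric.equicontinuousAt_iff]
      intro ε hε
      obtain ⟨d, hd, h⟩ := uc_of_ball hc hs (ε / 2) (by positivity)
      refine ⟨d, hd, ?_⟩
      rintro y hy ⟨_, k, rfl⟩
      have := (hv k).mod d _ h x y (by rw [← dist_eq_norm, dist_comm]; exact hy.le)
      change dist (vk k x) (vk k y) < ε
      rw [Real.dist_eq]; linarith
  obtain ⟨g, -, φ, hφ, hg⟩ := hcomp.tendsto_subseq (x := f)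
    (fun k => subset_closure (Set.mem_range_self k))
  refine ⟨φ, hφ, fun x => if hx : x ∈ Metric.closedBall (0 : E N) R then g ⟨x, hx⟩ else 0, ?_⟩
  intro x
  by_cases hx : x ∈ Metric.closedBall (0 : E N) R
  · simp only [hx, dif_pos]
    have := (BoundedContinuousFunction.tendsto_iff_tendstoUniformly.1 hg).tendsto_at ⟨x, hx⟩
    exact this
  · simp only [hx, dif_neg, not_false_eq_true]
    simp_rw [fun k => (hv (φ k)).supp x (by simpa using hx)]
    exact tendsto_const_nhds

noncomputable def gaus {N : ℕ} (x : E N) : ℝ := Real.exp (-‖x‖ ^ 2)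

lemma gaus_pos {N : ℕ} (x : E N) : 0 < gaus x := Real.exp_pos _

lemma gaus_le {N : ℕ} (x : E N) : gaus x ≤ 1 := by
  unfold gaus; rw [Real.exp_le_one_iff]; nlinarith [norm_nonneg x]

lemma gaus_cont {N : ℕ} : Continuous (gaus (N := N)) := by unfold gaus; fun_prop

noncomputable def Phi {N : ℕ} (v : E N → ℝ) : ℝ := ∫ x, v x * gaus x

lemma pcls_self {N : ℕ} {u : E N → ℝ} {R : ℝ} (h0 : ∀ x, 0 ≤ u x)
    (hs : ∀ x, R < ‖x‖ → u x = 0) : PCls u R u :=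
  ⟨h0, fun _ h => h, hs, fun _ _ h => h, fun _ _ _ => rfl, fun _ => le_rfl⟩

lemma exists_max {N : ℕ} {u : E N → ℝ} {R : ℝ} (hc : Continuous u) (h0 : ∀ x, 0 ≤ u x)
    (hs : ∀ x, R < ‖x‖ → u x = 0) : ∃ v, PCls u R v ∧ ∀ w, PCls u R w → Phi w ≤ Phi v := by
  obtain ⟨M, hM⟩ := bdd_of_ball hc hs
  have hM0 : 0 ≤ M := (abs_nonneg _).trans (hM 0)
  have hM' : ∀ x, u x ≤ M := fun x => (le_abs_self _).trans (hM x)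
  set S := Phi '' {v | PCls u R v} with hS
  have hne : S.Nonempty := ⟨_, u, pcls_self h0 hs, rfl⟩
  have cc : ∀ {v}, PCls u R v → Continuous v := fun hv => cont_of_mod hc hs hv.mod
  have hint : ∀ {v}, PCls u R v → Integrable fun x => v x * gaus x := fun {v} hv =>
    integrable_of_ball ((cc hv).mul gaus_cont) (R := R) fun x hx => by rw [hv.supp x hx, zero_mul]
  have hbd : BddAbove S := by
    refine ⟨∫ x, u x, ?_⟩
    rintro _ ⟨v, hv, rfl⟩
    have := hv.int id continuous_id rfl
    simp only [id] at this
    rw [← this]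
    apply integral_mono (hint hv) (integrable_of_ball (cc hv) hv.supp)
    intro x
    have := hv.nonneg x
    have := gaus_le x
    show v x * gaus x ≤ v x
    nlinarith
  obtain ⟨s, -, hs1, hs2⟩ := exists_seq_tendsto_sSup hne hbd
  choose vk hvk hvs using hs2
  obtain ⟨φ, hφ, v, hv⟩ := pcls_subseq hc hs hvk
  have hvP := pcls_lim hc hs (fun k => hvk (φ k)) hv
  refine ⟨v, hvP, fun w hw => ?_⟩
  have t1 : Tendsto (fun k => Phi (vk (φ k))) atTop (𝓝 (Phi v)) := by
    refine dct_ball R M (fun k => (cc (hvk _)).mul gaus_cont)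
      (fun k x hx => by rw [(hvk _).supp x hx, zero_mul]) (fun k x => ?_) (fun x => (hv x).mul_const _)
    have a1 := (hvk (φ k)).nonneg x
    have a2 := (hvk (φ k)).bdd M hM' x
    have a3 := gaus_le x
    have a4 := gaus_pos x
    rw [abs_of_nonneg (by positivity)]
    nlinarith
  have t2 : Tendsto (fun k => Phi (vk (φ k))) atTop (𝓝 (sSup S)) := by
    simp_rw [hvs]; exact hs1.comp hφ.tendsto_atTop
  rw [tendsto_nhds_unique t1 t2]
  exact le_csSup hbd ⟨w, hw, rfl⟩

lemma max_pol {N : ℕ} {u v : E N → ℝ} {R : ℝ} (hc : Continuous u)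
    (hs : ∀ x, R < ‖x‖ → u x = 0) (hv : PCls u R v) (hm : ∀ w, PCls u R w → Phi w ≤ Phi v)
    {e : E N} (he : ‖e‖ = 1) {c : ℝ} (hc0 : 0 < c) (x : E N) (hx : ⟪e, x⟫ < c) :
    v (sig e c x) ≤ v x := by
  have hp := pcls_pol he hc0.le hc hs hv
  have vc : Continuous v := cont_of_mod hc hs hv.mod
  have pc : Continuous (pol e c v) := cont_of_mod hc hs hp.mod
  have hle := hm _ hp
  set G : E N → ℝ := fun x => (pol e c v x - v x) * gaus x with hG
  have i1 : Integrable fun x => v x * gaus x :=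
    integrable_of_ball (vc.mul gaus_cont) (R := R) fun x hx => by rw [hv.supp x hx, zero_mul]
  have i2 : Integrable fun x => pol e c v x * gaus x :=
    integrable_of_ball (pc.mul gaus_cont) (R := R) fun x hx => by rw [hp.supp x hx, zero_mul]
  have Gi : Integrable G := by
    have := i2.sub i1
    refine this.congr (Eventually.of_forall fun x => ?_)
    simp [hG]; ring
  have GI : ∫ x, G x = Phi (pol e c v) - Phi v := by
    unfold Phi; rw [← integral_sub i2 i1]; congr 1; funext x; simp [hG]; ring
  have s := mp_sig he c
  have me : MeasurableEmbedding (sig e c) := by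
    refine (Homeomorph.mk ⟨sig e c, sig e c, sig_sig he c, sig_sig he c⟩
      (continuous_sig e c) (continuous_sig e c)).measurableEmbedding
  have j1 := s.integral_comp me G
  have k1 : Integrable (fun x => G (sig e c x)) := (s.integrable_comp Gi.1).2 Gi
  have gs : ∀ y : E N, ⟪e, y⟫ ≤ c → gaus (sig e c y) ≤ gaus y := by
    intro y hy
    unfold gaus; rw [Real.exp_le_exp, normsq_sig he]; nlinarith
  have key : ∀ y : E N, ⟪e, y⟫ ≤ c → 0 ≤ G y + G (sig e c y) := by
    intro y hy
    obtain ⟨h1, h2⟩ := pol_on he v hy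
    have g1 := gs y hy
    have g2 := gaus_pos y
    simp only [hG]
    rw [h1, h2]
    rcases le_total (v y) (v (sig e c y)) with h | h
    · rw [max_eq_right h, min_eq_left h]; nlinarith
    · rw [max_eq_left h, min_eq_right h]; simp
  have D0 : ∀ y, 0 ≤ G y + G (sig e c y) := by
    intro y
    rcases le_total (⟪e, y⟫) c with h | h
    · exact key y h
    · have := key (sig e c y) (by rw [inner_sig he]; linarith)
      rw [sig_sig he] at this; linarith
  have Dint : ∫ y, (G y + G (sig e c y)) = 0 := by
    apply le_antisymm _ (integral_nonneg D0)
    rw [integral_add Gi k1, j1, GI]; linarith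
  have Dc : Continuous fun y => G y + G (sig e c y) := by
    have : Continuous G := (pc.sub vc).mul gaus_cont
    exact this.add (this.comp (continuous_sig e c))
  have Dz := (integral_eq_zero_iff_of_nonneg D0 (Gi.add k1)).1 Dint
  have Dz' := (Continuous.ae_eq_iff_eq volume Dc continuous_const).1 Dz
  have hD : G x + G (sig e c x) = 0 := congrFun Dz' x
  by_contra hlt
  push Not at hlt
  obtain ⟨h1, h2⟩ := pol_on he v hx.le
  simp only [hG] at hD
  rw [h1, h2, max_eq_right hlt.le, min_eq_left hlt.le] at hD
  have : gaus (sig e c x) < gaus x := by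
    unfold gaus; rw [Real.exp_lt_exp, normsq_sig he]; nlinarith
  nlinarith

lemma max_mono {N : ℕ} {u v : E N → ℝ} {R : ℝ} (hc : Continuous u)
    (hs : ∀ x, R < ‖x‖ → u x = 0) (hv : PCls u R v) (hm : ∀ w, PCls u R w → Phi w ≤ Phi v)
    (a b : E N) (hab : ‖a‖ < ‖b‖) : v b ≤ v a := by
  have hne : b - a ≠ 0 := by
    intro h; rw [sub_eq_zero] at h; rw [h] at hab; exact lt_irrefl _ hab
  have hd : 0 < ‖b - a‖ := norm_pos_iff.2 hne
  have hsq : ‖a‖ ^ 2 < ‖b‖ ^ 2 := by nlinarith [norm_nonneg a]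
  have hn : ‖b - a‖ ^ 2 = ‖b‖ ^ 2 - 2 * ⟪b, a⟫ + ‖a‖ ^ 2 := norm_sub_sq_real b a
  set d := ‖b - a‖ with hdd
  set e : E N := d⁻¹ • (b - a) with hee
  set c : ℝ := (‖b‖ ^ 2 - ‖a‖ ^ 2) / (2 * d) with hcc
  have he : ‖e‖ = 1 := by
    rw [hee, norm_smul, norm_inv, norm_norm]; exact inv_mul_cancel₀ hd.ne'
  have hia : ⟪e, a⟫ = (⟪b, a⟫ - ‖a‖ ^ 2) / d := by
    rw [hee, inner_smul_left, inner_sub_left, real_inner_self_eq_norm_sq]; simp; ring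
  have hdiff : ⟪e, a⟫ - c = - d / 2 := by
    rw [hia, hcc]; field_simp; linarith
  have hsig : sig e c a = b := by
    unfold sig; rw [hdiff, hee, smul_smul]
    have : 2 * (-d / 2) * d⁻¹ = -1 := by field_simp
    rw [this]; simp
  have := max_pol hc hs hv hm he (c := c) (by rw [hcc]; apply div_pos <;> linarith) a (by linarith)
  rwa [hsig] at this

/-- Existence of a radial symmetrization. -/
lemma exists_radial {N : ℕ} {u : E N → ℝ} {R : ℝ} (hc : Continuous u) (h0 : ∀ x, 0 ≤ u x)
    (hs : ∀ x, R < ‖x‖ → u x = 0) : ∃ v, PCls u R v ∧ Continuous v ∧ Radial N v := by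
  obtain ⟨v, hv, hm⟩ := exists_max hc h0 hs
  have vc : Continuous v := cont_of_mod hc hs hv.mod
  refine ⟨v, hv, vc, ?_⟩
  have key : ∀ x y : E N, ‖x‖ = ‖y‖ → v x ≤ v y := by
    intro x y hxy
    by_cases hx : x = 0
    · subst hx; rw [norm_zero] at hxy; rw [norm_eq_zero.1 hxy.symm]
    have hxp : 0 < ‖x‖ := norm_pos_iff.2 hx
    have t : Tendsto (fun s : ℝ => v (s • x)) (𝓝[>] 1) (𝓝 (v x)) := by
      have : Continuous fun s : ℝ => v (s • x) := by fun_prop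
      have := this.tendsto 1
      rw [one_smul] at this
      exact this.mono_left nhdsWithin_le_nhds
    refine le_of_tendsto t ?_
    filter_upwards [self_mem_nhdsWithin] with s hs1
    have hs1 : 1 < s := hs1
    apply max_mono hc hs hv hm
    rw [norm_smul, Real.norm_eq_abs, abs_of_pos (by linarith), ← hxy]
    nlinarith
  exact fun x y h => le_antisymm (key x y h) (key y x h.symm)

noncomputable def Tz {N : ℕ} (v : E N → ℝ) (z : E N) : ℝ≥0∞ :=
  ∫⁻ x, ENNReal.ofReal ((v (x + z) - v x) ^ 2)

lemma Tz_meas {N : ℕ} {v : E N → ℝ} (hv : Measurable v) : Measurable (Tz v) := by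
  unfold Tz
  apply Measurable.lintegral_prod_right' (f := fun q : E N × E N => ENNReal.ofReal ((v (q.2 + q.1) - v q.2) ^ 2))
  fun_prop

lemma KE_eq {N : ℕ} (h : ℝ) {v : E N → ℝ} (hv : Measurable v) :
    KE h v = ∫⁻ z, ENNReal.ofReal (ker1 h ‖z‖) * Tz v z := by
  have hk := measurable_ker1 h
  unfold KE
  rw [lintegral_prod _ (KE_meas h hv).aemeasurable]
  have : ∀ x : E N, ∫⁻ y, ENNReal.ofReal (ker1 h ‖x - y‖ * (v x - v y) ^ 2) =
      ∫⁻ z, ENNReal.ofReal (ker1 h ‖z‖) * ENNReal.ofReal ((v (x + z) - v x) ^ 2) := by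
    intro x
    rw [← lintegral_add_left_eq_self _ x]
    congr 1; funext z
    rw [ENNReal.ofReal_mul (ker1_nonneg _ _)]
    rw [show x - (x + z) = - z by abel, norm_neg, show (v x - v (x + z)) ^ 2 = (v (x + z) - v x) ^ 2 by ring]
  simp_rw [this]
  rw [lintegral_lintegral_swap]
  · congr 1; funext z
    unfold Tz
    rw [lintegral_const_mul]
    fun_prop
  · have h1 : Measurable (fun q : E N × E N => ker1 h ‖q.2‖) := hk.comp (by fun_prop)
    apply Measurable.aemeasurable
    unfold Function.uncurry
    fun_prop

lemma sq_int_le {α : Type*} [MeasurableSpace α] (μ : Measure α) [IsProbabilityMeasure μ]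
    {G : α → ℝ} (hG : AEStronglyMeasurable G μ) :
    ENNReal.ofReal ((∫ x, G x ∂μ) ^ 2) ≤ ∫⁻ x, ENNReal.ofReal (G x ^ 2) ∂μ := by
  by_cases ht : ∫⁻ x, ENNReal.ofReal (G x ^ 2) ∂μ = ∞
  · rw [ht]; exact le_top
  have hi : Integrable (fun x => G x ^ 2) μ := by
    refine ⟨hG.pow 2, ?_⟩
    rw [hasFiniteIntegral_iff_ofReal (Eventually.of_forall fun x => sq_nonneg _)]
    exact lt_top_iff_ne_top.2 ht
  have hm : MemLp G 2 μ := (memLp_two_iff_integrable_sq hG).2 hi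
  have h1 := ProbabilityTheory.variance_eq_sub hm
  have h2 := ProbabilityTheory.variance_nonneg G μ
  rw [← ofReal_integral_eq_lintegral_ofReal hi (Eventually.of_forall fun x => sq_nonneg _)]
  apply ENNReal.ofReal_le_ofReal
  have : ∫ x, (G ^ 2) x ∂μ = ∫ x, G x ^ 2 ∂μ := rfl
  linarith

lemma grad_meas {N : ℕ} (w : E N → ℝ) : Measurable (gradient w) := by
  unfold gradient
  exact (InnerProductSpace.toDual ℝ (E N)).symm.continuous.measurable.comp (measurable_fderiv ℝ w)

lemma line_le {N : ℕ} {w : E N → ℝ} (hw : Differentiable ℝ w) (x z : E N) :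
    ENNReal.ofReal ((w (x + z) - w x) ^ 2) ≤
      ∫⁻ t in Set.Ioc (0:ℝ) 1, ENNReal.ofReal (⟪gradient w (x + t • z), z⟫ ^ 2) := by
  set G : ℝ → ℝ := fun t => ⟪gradient w (x + t • z), z⟫ with hG
  have hp : IsProbabilityMeasure ((volume : Measure ℝ).restrict (Set.Ioc (0:ℝ) 1)) := ⟨by simp⟩
  have gm := grad_meas w
  have Gm : Measurable G := by
    have : Measurable fun t : ℝ => gradient w (x + t • z) := gm.comp (by fun_prop)
    exact this.inner measurable_const
  by_cases ht : ∫⁻ t in Set.Ioc (0:ℝ) 1, ENNReal.ofReal (G t ^ 2) = ∞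
  · rw [ht]; exact le_top
  have hi : Integrable (fun x => G x ^ 2) (volume.restrict (Set.Ioc (0:ℝ) 1)) := by
    refine ⟨(Gm.pow_const 2).aestronglyMeasurable, ?_⟩
    rw [hasFiniteIntegral_iff_ofReal (Eventually.of_forall fun x => sq_nonneg _)]
    exact lt_top_iff_ne_top.2 ht
  have hm : MemLp G 2 (volume.restrict (Set.Ioc (0:ℝ) 1)) :=
    (memLp_two_iff_integrable_sq Gm.aestronglyMeasurable).2 hi
  have hii : IntervalIntegrable G volume 0 1 := by
    rw [intervalIntegrable_iff, Set.uIoc_of_le zero_le_one]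
    exact hm.integrable (by norm_num)
  have ftc := intervalIntegral.integral_eq_sub_of_hasDerivAt (a := 0) (b := 1)
    (f := fun t : ℝ => w (x + t • z)) (f' := G) (fun t _ => by
      have h1 := (hw (x + t • z)).hasFDerivAt
      have h2 : HasDerivAt (fun t : ℝ => x + t • z) z t := by
        simpa using ((hasDerivAt_id t).smul_const z).const_add x
      have := h1.comp_hasDerivAt t h2
      rw [hG]
      simp only [inner_gradient_left]
      exact this) hii
  simp only [one_smul, zero_smul, add_zero] at ftc
  rw [← ftc, intervalIntegral.integral_of_le zero_le_one]
  exact sq_int_le _ Gm.aestronglyMeasurable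

lemma Tz_le {N : ℕ} {w : E N → ℝ} (hw : Differentiable ℝ w) (z : E N) :
    Tz w z ≤ ∫⁻ x, ENNReal.ofReal (⟪gradient w x, z⟫ ^ 2) := by
  have gm := grad_meas w
  calc Tz w z ≤ ∫⁻ x, ∫⁻ t in Set.Ioc (0:ℝ) 1, ENNReal.ofReal (⟪gradient w (x + t • z), z⟫ ^ 2) :=
        lintegral_mono fun x => line_le hw x z
    _ = ∫⁻ t in Set.Ioc (0:ℝ) 1, ∫⁻ x, ENNReal.ofReal (⟪gradient w (x + t • z), z⟫ ^ 2) := by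
        apply lintegral_lintegral_swap
        apply Measurable.aemeasurable
        have : Measurable fun q : E N × ℝ => gradient w (q.1 + q.2 • z) := gm.comp (by fun_prop)
        have h3 : Measurable fun q : E N × ℝ => ⟪gradient w (q.1 + q.2 • z), z⟫ :=
          this.inner measurable_const
        exact (h3.pow_const 2).ennreal_ofReal
    _ = ∫⁻ t in Set.Ioc (0:ℝ) 1, ∫⁻ x, ENNReal.ofReal (⟪gradient w x, z⟫ ^ 2) := by
        congr 1; funext t
        exact lintegral_add_right_eq_self (fun x => ENNReal.ofReal (⟪gradient w x, z⟫ ^ 2)) (t • z)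
    _ = _ := by simp

/-- the constant -/
noncomputable def cc1 {N : ℕ} (h : ℝ) (e0 : E N) : ℝ≥0∞ :=
  ∫⁻ z, ENNReal.ofReal (ker1 h ‖z‖) * ENNReal.ofReal (⟪e0, z⟫ ^ 2)

lemma cc1_eq {N : ℕ} (h : ℝ) {e0 : E N} (he : ‖e0‖ = 1) (g : E N) :
    ∫⁻ z, ENNReal.ofReal (ker1 h ‖z‖) * ENNReal.ofReal (⟪g, z⟫ ^ 2) =
      cc1 h e0 * ENNReal.ofReal (‖g‖ ^ 2) := by
  have hk := measurable_ker1 h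
  have h1 : Measurable (fun q : E N => ker1 h ‖q‖) := hk.comp (by fun_prop)
  set L := (Submodule.reflection (ℝ ∙ (g - ‖g‖ • e0))ᗮ) with hL
  have hLg : L g = ‖g‖ • e0 := Submodule.reflection_sub (by rw [norm_smul, he]; simp)
  have := L.measurePreserving.lintegral_comp_emb L.toHomeomorph.measurableEmbedding
    (fun z => ENNReal.ofReal (ker1 h ‖z‖) * ENNReal.ofReal (⟪‖g‖ • e0, z⟫ ^ 2))
  have e2 : ∀ z, ⟪‖g‖ • e0, L z⟫ = ⟪g, z⟫ := by
    intro z; rw [← hLg, L.inner_map_map]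
  simp only [LinearIsometryEquiv.norm_map, e2] at this
  rw [this]
  unfold cc1
  rw [← lintegral_mul_const]
  · congr 1; funext z
    rw [inner_smul_left, mul_assoc, ← ENNReal.ofReal_mul (sq_nonneg _)]
    congr 2; simp; ring
  · fun_prop

lemma KE_le {N : ℕ} {w : E N → ℝ} (hw : Differentiable ℝ w) (h : ℝ) {e0 : E N} (he : ‖e0‖ = 1) :
    KE h w ≤ cc1 h e0 * ∫⁻ x, ENNReal.ofReal (‖gradient w x‖ ^ 2) := by
  have gm := grad_meas w
  have hk := measurable_ker1 h
  have h1 : Measurable (fun q : E N × E N => ker1 h ‖q.1‖) := hk.comp (by fun_prop)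
  rw [KE_eq h hw.continuous.measurable]
  calc _ ≤ ∫⁻ z, ENNReal.ofReal (ker1 h ‖z‖) * ∫⁻ x, ENNReal.ofReal (⟪gradient w x, z⟫ ^ 2) :=
        lintegral_mono fun z => by gcongr; exact Tz_le hw z
    _ = ∫⁻ z, ∫⁻ x, ENNReal.ofReal (ker1 h ‖z‖) * ENNReal.ofReal (⟪gradient w x, z⟫ ^ 2) := by
        congr 1; funext z
        rw [lintegral_const_mul]
        exact ((gm.inner measurable_const).pow_const 2).ennreal_ofReal
    _ = ∫⁻ x, ∫⁻ z, ENNReal.ofReal (ker1 h ‖z‖) * ENNReal.ofReal (⟪gradient w x, z⟫ ^ 2) := by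
        apply lintegral_lintegral_swap
        apply Measurable.aemeasurable
        have : Measurable fun q : E N × E N => gradient w q.2 := gm.comp measurable_snd
        exact h1.ennreal_ofReal.mul ((this.inner measurable_fst).pow_const 2).ennreal_ofReal
    _ = ∫⁻ x, cc1 h e0 * ENNReal.ofReal (‖gradient w x‖ ^ 2) := by
        simp_rw [cc1_eq h he]
    _ = _ := by
        rw [lintegral_const_mul]
        exact (gm.norm.pow_const 2).ennreal_ofReal

lemma lint_scale {N : ℕ} {h : ℝ} (hh : 0 < h) {f : E N → ℝ≥0∞} (hf : Measurable f) :
    ∫⁻ z, f z = ENNReal.ofReal (h ^ N) * ∫⁻ z, f (h • z) := by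
  have := Measure.map_addHaar_smul (volume : Measure (E N)) hh.ne'
  have h2 : ∫⁻ z, f (h • z) = ∫⁻ z, f z ∂(Measure.map (fun z => h • z) volume) := by
    rw [lintegral_map hf (by fun_prop)]
  rw [h2, this, lintegral_smul_measure]
  simp only [finrank_euclideanSpace, Fintype.card_fin, smul_eq_mul]
  rw [← mul_assoc, ← ENNReal.ofReal_mul (by positivity), abs_of_pos (by positivity),
    mul_inv_cancel₀ (by positivity)]
  simp

lemma ker1_scale {h : ℝ} (hh : 0 < h) (t : ℝ) : ker1 h (h * t) = ker1 1 t := by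
  unfold ker1
  have : h * t < h ↔ t < 1 := by
    constructor <;> intro H <;> nlinarith
  simp [this]

lemma cc1_scale {N : ℕ} {h : ℝ} (hh : 0 < h) (e0 : E N) :
    cc1 h e0 = ENNReal.ofReal (h ^ N) * (ENNReal.ofReal (h ^ 2) * cc1 1 e0) := by
  have hk := measurable_ker1 h
  have h1 : Measurable (fun q : E N => ker1 h ‖q‖) := hk.comp (by fun_prop)
  have hk' := measurable_ker1 1
  have h1' : Measurable (fun q : E N => ker1 1 ‖q‖) := hk'.comp (by fun_prop)
  unfold cc1
  rw [lint_scale hh (by fun_prop)]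
  congr 1
  rw [← lintegral_const_mul _ (by fun_prop)]
  congr 1; funext z
  rw [norm_smul, Real.norm_eq_abs, abs_of_pos hh, ker1_scale hh, inner_smul_right, mul_pow,
    ENNReal.ofReal_mul (by positivity)]
  ring

lemma KE_scale {N : ℕ} {h : ℝ} (hh : 0 < h) {v : E N → ℝ} (hv : Measurable v) :
    KE h v = ENNReal.ofReal (h ^ N) * (ENNReal.ofReal (h ^ 2) *
      ∫⁻ z, ∫⁻ x, ENNReal.ofReal (ker1 1 ‖z‖) * ENNReal.ofReal ((h⁻¹ * (v (x + h • z) - v x)) ^ 2)) := by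
  have hk := measurable_ker1 h
  have h1 : Measurable (fun q : E N => ker1 h ‖q‖) := hk.comp (by fun_prop)
  have hT := Tz_meas hv
  have hk' := measurable_ker1 1
  have h1' : Measurable (fun q : E N => ker1 1 ‖q‖) := hk'.comp (by fun_prop)
  rw [KE_eq h hv, lint_scale hh (by fun_prop)]
  congr 1
  rw [← lintegral_const_mul]
  · congr 1; funext z
    rw [norm_smul, Real.norm_eq_abs, abs_of_pos hh, ker1_scale hh]
    unfold Tz
    rw [← lintegral_const_mul _ (by fun_prop), ← lintegral_const_mul _ (by fun_prop)]
    congr 1; funext x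
    rw [mul_pow, ENNReal.ofReal_mul (p := h⁻¹ ^ 2) (by positivity)]
    have : ENNReal.ofReal (h ^ 2) * ENNReal.ofReal (h⁻¹ ^ 2) = 1 := by
      rw [← ENNReal.ofReal_mul (by positivity), ← mul_pow, mul_inv_cancel₀ hh.ne']; simp
    calc _ = ENNReal.ofReal (ker1 1 ‖z‖) * ENNReal.ofReal ((v (x + h • z) - v x) ^ 2) * 1 := by ring
      _ = _ := by rw [← this]; ring
  · apply Measurable.lintegral_prod_right' (f := fun q : E N × E N => ENNReal.ofReal (ker1 1 ‖q.1‖) *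
      ENNReal.ofReal ((h⁻¹ * (v (q.2 + h • q.1) - v q.2)) ^ 2))
    have : Measurable (fun q : E N × E N => ker1 1 ‖q.1‖) := h1'.comp measurable_fst
    fun_prop

lemma cc1_pos {N : ℕ} {e0 : E N} (he : ‖e0‖ = 1) : cc1 1 e0 ≠ 0 := by
  have hk' := measurable_ker1 1
  have h1' : Measurable (fun q : E N => ker1 1 ‖q‖) := hk'.comp (by fun_prop)
  unfold cc1
  apply ne_of_gt
  rw [lintegral_pos_iff_support (by fun_prop)]
  set U : Set (E N) := {z | ‖z‖ < 1 ∧ 0 < ⟪e0, z⟫}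
  have hcin : Continuous fun z : E N => ⟪e0, z⟫ := by fun_prop
  have hU1 : IsOpen {z : E N | 0 < ⟪e0, z⟫} := isOpen_lt continuous_const hcin
  have hU : IsOpen U := (isOpen_lt continuous_norm continuous_const).inter hU1
  have hne : U.Nonempty := by
    refine ⟨(1/2 : ℝ) • e0, ?_, ?_⟩
    · rw [norm_smul, he]; norm_num
    · rw [inner_smul_right, real_inner_self_eq_norm_sq, he]; norm_num
  refine (hU.measure_pos volume hne).trans_le (measure_mono ?_)
  rintro z ⟨h1, h2⟩
  rw [Function.mem_support]
  have : ker1 1 ‖z‖ = 1 := by simp [ker1, h1]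
  rw [this]
  simp
  exact h2.ne'

lemma cc1_fin {N : ℕ} {e0 : E N} (he : ‖e0‖ = 1) : cc1 1 e0 ≠ ∞ := by
  unfold cc1
  apply ne_of_lt
  calc _ ≤ ∫⁻ z : E N, (Metric.ball (0 : E N) 1).indicator (fun _ => (1 : ℝ≥0∞)) z := by
        apply lintegral_mono
        intro z
        by_cases hz : ‖z‖ < 1
        · have : z ∈ Metric.ball (0 : E N) 1 := by simpa using hz
          rw [Set.indicator_of_mem this]
          have : ker1 1 ‖z‖ = 1 := by simp [ker1, hz]
          simp only [this]
          simp only [ENNReal.ofReal_one, one_mul, ENNReal.ofReal_le_one]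
          have := abs_real_inner_le_norm e0 z
          rw [he, one_mul] at this
          rw [← sq_abs]
          nlinarith [abs_nonneg ⟪e0, z⟫]
        · have : ker1 1 ‖z‖ = 0 := by simp [ker1, hz]
          simp [this]
    _ < ∞ := by
        rw [lintegral_indicator_const Metric.isOpen_ball.measurableSet]
        simpa using measure_ball_lt_top

lemma grad_le_of_KE {N : ℕ} {w : E N → ℝ} (hw : Differentiable ℝ w) {e0 : E N} (he : ‖e0‖ = 1)
    {M : ℝ≥0∞} (hM : ∀ h, 0 < h → KE h w ≤ cc1 h e0 * M) :
    ∫⁻ x, ENNReal.ofReal (‖gradient w x‖ ^ 2) ≤ M := by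
  have gm := grad_meas w
  have wm := hw.continuous.measurable
  have hk' := measurable_ker1 1
  have h1' : Measurable (fun q : E N => ker1 1 ‖q‖) := hk'.comp (by fun_prop)
  have h2' : Measurable (fun q : E N × E N => ker1 1 ‖q.1‖) := h1'.comp measurable_fst
  set Q : ℝ → E N × E N → ℝ≥0∞ := fun h q => ENNReal.ofReal (ker1 1 ‖q.1‖) *
    ENNReal.ofReal ((h⁻¹ * (w (q.2 + h • q.1) - w q.2)) ^ 2) with hQ
  have Qm : ∀ h, Measurable (Q h) := fun h => by simp only [hQ]; fun_prop
  have hle : ∀ h, 0 < h → ∫⁻ q, Q h q ∂((volume : Measure (E N)).prod volume) ≤ cc1 1 e0 * M := by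
    intro h hh
    have := hM h hh
    rw [KE_scale hh wm, cc1_scale hh, mul_assoc, mul_assoc] at this
    rw [ENNReal.mul_le_mul_iff_right (by simp; positivity) (by simp),
      ENNReal.mul_le_mul_iff_right (by simp; positivity) (by simp)] at this
    rw [lintegral_prod _ (Qm h).aemeasurable]
    exact this
  set hk : ℕ → ℝ := fun k => 1 / ((k : ℝ) + 1)
  have hkp : ∀ k, 0 < hk k := fun k => by positivity
  have hk0 : Tendsto hk atTop (𝓝 0) := tendsto_one_div_add_atTop_nhds_zero_nat
  have lim : ∀ q : E N × E N, Tendsto (fun k => Q (hk k) q) atTop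
      (𝓝 (ENNReal.ofReal (ker1 1 ‖q.1‖) * ENNReal.ofReal (⟪gradient w q.2, q.1⟫ ^ 2))) := by
    intro q
    apply ENNReal.Tendsto.const_mul _ (Or.inr ENNReal.ofReal_ne_top)
    apply ENNReal.tendsto_ofReal
    apply Tendsto.pow
    rw [inner_gradient_left]
    have h2 : HasDerivAt (fun t : ℝ => q.2 + t • q.1) q.1 0 := by
      simpa using ((hasDerivAt_id (0:ℝ)).smul_const q.1).const_add q.2
    have h1 : HasFDerivAt w (fderiv ℝ w q.2) (q.2 + (0:ℝ) • q.1) := by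
      simpa using (hw q.2).hasFDerivAt
    have := (h1.comp_hasDerivAt 0 h2).tendsto_slope_zero
    simp only [Function.comp, zero_add, zero_smul, add_zero, smul_eq_mul] at this
    refine this.comp ?_
    rw [tendsto_nhdsWithin_iff]
    exact ⟨hk0, Eventually.of_forall fun k => (hkp k).ne'⟩
  have fat : ∫⁻ q : E N × E N, ENNReal.ofReal (ker1 1 ‖q.1‖) * ENNReal.ofReal (⟪gradient w q.2, q.1⟫ ^ 2)
      ∂((volume : Measure (E N)).prod volume) ≤ cc1 1 e0 * M := by
    calc _ = ∫⁻ q, liminf (fun k => Q (hk k) q) atTop ∂((volume : Measure (E N)).prod volume) := by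
          congr 1; funext q; exact (lim q).liminf_eq.symm
      _ ≤ liminf (fun k => ∫⁻ q, Q (hk k) q ∂((volume : Measure (E N)).prod volume)) atTop :=
          lintegral_liminf_le fun k => Qm _
      _ ≤ _ := by
          apply liminf_le_of_le
          · isBoundedDefault
          · intro b hb
            obtain ⟨k, hk⟩ := hb.exists
            exact hk.trans (hle _ (hkp k))
  rw [lintegral_prod_symm] at fat
  · simp only [cc1_eq 1 he] at fat
    rw [lintegral_const_mul _ ((gm.norm.pow_const 2).ennreal_ofReal)] at fat
    rwa [ENNReal.mul_le_mul_iff_right (cc1_pos he) (cc1_fin he)] at fat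
  · have : Measurable fun q : E N × E N => gradient w q.2 := gm.comp measurable_snd
    exact (h2'.ennreal_ofReal.mul ((this.inner measurable_fst).pow_const 2).ennreal_ofReal).aemeasurable

lemma KE_abs {N : ℕ} (h : ℝ) (f : E N → ℝ) : KE h (fun x => |f x|) ≤ KE h f := by
  unfold KE
  apply lintegral_mono
  intro q
  apply ENNReal.ofReal_le_ofReal
  apply mul_le_mul_of_nonneg_left _ (ker1_nonneg _ _)
  rw [sq_le_sq]
  exact abs_abs_sub_abs_le_abs_sub (f q.1) (f q.2)

noncomputable def eta0 {N : ℕ} (δ : ℝ) (x : E N) : ℝ := Real.smoothTransition (1 - ‖x‖ ^ 2 / δ ^ 2)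

lemma eta0_smooth {N : ℕ} (δ : ℝ) : ContDiff ℝ (⊤ : ℕ∞) (eta0 (N := N) δ) := by
  unfold eta0
  apply Real.smoothTransition.contDiff.comp
  exact contDiff_const.sub ((contDiff_norm_sq ℝ).div_const _)

lemma eta0_supp {N : ℕ} {δ : ℝ} (hδ : 0 < δ) (x : E N) (hx : δ < ‖x‖) : eta0 δ x = 0 := by
  unfold eta0
  apply Real.smoothTransition.zero_of_nonpos
  rw [sub_nonpos, le_div_iff₀ (by positivity)]
  nlinarith

lemma eta0_nonneg {N : ℕ} (δ : ℝ) (x : E N) : 0 ≤ eta0 δ x := Real.smoothTransition.nonneg _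

lemma eta0_int {N : ℕ} {δ : ℝ} (hδ : 0 < δ) : Integrable (eta0 (N := N) δ) :=
  integrable_of_ball (eta0_smooth δ).continuous (eta0_supp hδ)

lemma eta0_pos {N : ℕ} {δ : ℝ} (hδ : 0 < δ) : 0 < ∫ x : E N, eta0 δ x := by
  apply (eta0_smooth δ).continuous.integral_pos_of_hasCompactSupport_nonneg_nonzero
    (hcs_of_ball (eta0_supp hδ)) (eta0_nonneg δ) (x := 0)
  unfold eta0
  simp

noncomputable def eta {N : ℕ} (δ : ℝ) (x : E N) : ℝ := (∫ y : E N, eta0 δ y)⁻¹ * eta0 δ x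

lemma eta_nonneg {N : ℕ} {δ : ℝ} (hδ : 0 < δ) (x : E N) : 0 ≤ eta δ x :=
  mul_nonneg (inv_nonneg.2 (eta0_pos hδ).le) (eta0_nonneg _ _)

lemma eta_smooth {N : ℕ} (δ : ℝ) : ContDiff ℝ (⊤ : ℕ∞) (eta (N := N) δ) :=
  contDiff_const.mul (eta0_smooth δ)

lemma eta_supp {N : ℕ} {δ : ℝ} (hδ : 0 < δ) (x : E N) (hx : δ < ‖x‖) : eta δ x = 0 := by
  unfold eta; rw [eta0_supp hδ x hx, mul_zero]

lemma eta_integral {N : ℕ} {δ : ℝ} (hδ : 0 < δ) : ∫ x : E N, eta δ x = 1 := by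
  unfold eta
  rw [integral_const_mul, inv_mul_cancel₀ (eta0_pos hδ).ne']

noncomputable def muE (N : ℕ) (δ : ℝ) : Measure (E N) :=
  volume.withDensity fun x => ENNReal.ofReal (eta δ x)

lemma muE_prob (N : ℕ) {δ : ℝ} (hδ : 0 < δ) : IsProbabilityMeasure (muE N δ) := by
  constructor
  unfold muE
  rw [withDensity_apply _ MeasurableSet.univ, Measure.restrict_univ,
    ← ofReal_integral_eq_lintegral_ofReal (integrable_of_ball (eta_smooth δ).continuous (eta_supp hδ))
    (Eventually.of_forall (eta_nonneg hδ)), eta_integral hδ]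
  simp

lemma muE_ae (N : ℕ) {δ : ℝ} (hδ : 0 < δ) : ∀ᵐ y ∂(muE N δ), ‖y‖ ≤ δ := by
  unfold muE
  rw [ae_withDensity_iff (eta_smooth δ).continuous.measurable.ennreal_ofReal]
  refine Eventually.of_forall fun x hx => ?_
  by_contra h
  push Not at h
  rw [eta_supp hδ x h] at hx
  simp at hx

noncomputable def moll {N : ℕ} (δ : ℝ) (v : E N → ℝ) (x : E N) : ℝ := ∫ y, v (x - y) ∂(muE N δ)

lemma moll_eq {N : ℕ} {δ : ℝ} (hδ : 0 < δ) (v : E N → ℝ) (x : E N) :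
    moll δ v x = ∫ y, eta δ y * v (x - y) := by
  unfold moll muE
  rw [integral_withDensity_eq_integral_toReal_smul]
  · congr 1; funext y
    rw [ENNReal.toReal_ofReal (eta_nonneg hδ y), smul_eq_mul]
  · exact (eta_smooth δ).continuous.measurable.ennreal_ofReal
  · exact Eventually.of_forall fun x => ENNReal.ofReal_lt_top

lemma moll_smooth {N : ℕ} {δ : ℝ} (hδ : 0 < δ) {v : E N → ℝ} (hv : Continuous v) :
    ContDiff ℝ (⊤ : ℕ∞) (moll δ v) := by
  have : moll δ v = MeasureTheory.convolution (eta δ) v (ContinuousLinearMap.lsmul ℝ ℝ) volume := by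
    funext x
    rw [moll_eq hδ]; rfl
  rw [this]
  exact (hcs_of_ball (eta_supp hδ)).contDiff_convolution_left _ (eta_smooth δ) hv.locallyIntegrable

lemma moll_nonneg {N : ℕ} {δ : ℝ} {v : E N → ℝ} (hv : ∀ x, 0 ≤ v x) (x : E N) :
    0 ≤ moll δ v x := integral_nonneg fun _ => hv _

lemma moll_supp {N : ℕ} {δ R : ℝ} (hδ : 0 < δ) {v : E N → ℝ} (hs : ∀ x, R < ‖x‖ → v x = 0)
    (x : E N) (hx : R + δ < ‖x‖) : moll δ v x = 0 := by
  unfold moll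
  apply integral_eq_zero_of_ae
  filter_upwards [muE_ae N hδ] with y hy
  apply hs
  have := norm_sub_norm_le x y
  linarith

lemma moll_close {N : ℕ} {δ ε : ℝ} (hδ : 0 < δ) {v : E N → ℝ} (hc : Continuous v) {M : ℝ}
    (hM : ∀ x, |v x| ≤ M)
    (h : ∀ x y, ‖x - y‖ ≤ δ → |v x - v y| ≤ ε) (x : E N) : |moll δ v x - v x| ≤ ε := by
  have := muE_prob N hδ
  have i1 : Integrable (fun y => v (x - y)) (muE N δ) :=
    Integrable.of_bound (by fun_prop) M (Eventually.of_forall fun y => hM _)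
  have : moll δ v x - v x = ∫ y, (v (x - y) - v x) ∂(muE N δ) := by
    rw [integral_sub i1 (integrable_const _)]; simp [moll]
  rw [this]
  have := norm_integral_le_of_norm_le_const (μ := muE N δ) (f := fun y => v (x - y) - v x) (C := ε) (by
    filter_upwards [muE_ae N hδ] with y hy
    apply h
    simpa using hy)
  simpa using this

lemma moll_radial {N : ℕ} {δ : ℝ} (hδ : 0 < δ) {v : E N → ℝ} (hv : Radial N v) :
    Radial N (moll δ v) := by
  intro x x' hx
  set L := (Submodule.reflection (ℝ ∙ (x - x'))ᗮ) with hL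
  have hLg : L x = x' := Submodule.reflection_sub hx
  rw [moll_eq hδ, moll_eq hδ]
  rw [← L.measurePreserving.integral_comp L.toHomeomorph.measurableEmbedding
    (fun y => eta δ y * v (x' - y))]
  congr 1; funext y
  have e1 : eta δ (L y) = eta δ y := by unfold eta eta0; rw [L.norm_map]
  have e2 : v (x' - L y) = v (x - y) := by
    apply hv; rw [← hLg, ← map_sub, L.norm_map]
  rw [e1, e2]

lemma moll_sq {N : ℕ} {δ : ℝ} (hδ : 0 < δ) {f : E N → ℝ} (hf : Continuous f) :
    ∫⁻ x, ENNReal.ofReal ((moll δ f x) ^ 2) ≤ ∫⁻ x, ENNReal.ofReal (f x ^ 2) := by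
  have hp := muE_prob N hδ
  have fm := hf.measurable
  calc _ ≤ ∫⁻ x, ∫⁻ y, ENNReal.ofReal (f (x - y) ^ 2) ∂(muE N δ) := by
        apply lintegral_mono
        intro x
        exact sq_int_le _ (by fun_prop)
    _ = ∫⁻ y, (∫⁻ x, ENNReal.ofReal (f (x - y) ^ 2)) ∂(muE N δ) := by
        apply lintegral_lintegral_swap
        apply Measurable.aemeasurable
        unfold Function.uncurry
        fun_prop
    _ = ∫⁻ y, (∫⁻ x, ENNReal.ofReal (f x ^ 2)) ∂(muE N δ) := by
        congr 1; funext y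
        exact lintegral_sub_right_eq_self (fun x => ENNReal.ofReal (f x ^ 2)) y
    _ = _ := by simp

lemma moll_KE {N : ℕ} {δ : ℝ} (hδ : 0 < δ) {v : E N → ℝ} (hv : Continuous v) {M : ℝ}
    (hM : ∀ x, |v x| ≤ M) (h : ℝ) : KE h (moll δ v) ≤ KE h v := by
  have hp := muE_prob N hδ
  rw [KE_eq h hv.measurable, KE_eq h (moll_smooth hδ hv).continuous.measurable]
  apply lintegral_mono
  intro z
  apply mul_le_mul_right
  unfold Tz
  have := moll_sq hδ (f := fun x => v (x + z) - v x) (by fun_prop)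
  refine le_trans (le_of_eq ?_) this
  congr 1; funext x
  congr 2
  unfold moll
  rw [integral_sub]
  · congr 2; funext y; congr 1; abel
  · exact Integrable.of_bound (by fun_prop) M (Eventually.of_forall fun y => hM _)
  · exact Integrable.of_bound (by fun_prop) M (Eventually.of_forall fun y => hM _)

lemma exists_moll {N : ℕ} {R q : ℝ} (hq : 0 < q) {v : E N → ℝ} (hv : Continuous v)
    (h0 : ∀ x, 0 ≤ v x) (hr : Radial N v) (hs : ∀ x, R < ‖x‖ → v x = 0) {ε : ℝ} (hε : 0 < ε) :
    ∃ w : E N → ℝ, ContDiff ℝ (⊤ : ℕ∞) w ∧ (∀ x, 0 ≤ w x) ∧ Radial N w ∧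
      (∀ x, R + 1 < ‖x‖ → w x = 0) ∧ (∀ h, KE h w ≤ KE h v) ∧
      ∫⁻ x, ENNReal.ofReal (w x ^ 2) ≤ ∫⁻ x, ENNReal.ofReal (v x ^ 2) ∧
      (∫ x, v x ^ q) - ε < ∫ x, w x ^ q := by
  obtain ⟨M, hM⟩ := bdd_of_ball hv hs
  have hM0 : 0 ≤ M := (abs_nonneg _).trans (hM 0)
  set hk : ℕ → ℝ := fun k => 1 / ((k : ℝ) + 1)
  have hkp : ∀ k, 0 < hk k := fun k => by positivity
  have hk1 : ∀ k, hk k ≤ 1 := fun k => by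
    simp only [hk]; rw [div_le_one (by positivity)]; linarith [(Nat.cast_nonneg k : (0:ℝ) ≤ k)]
  have hk0 : Tendsto hk atTop (𝓝 0) := tendsto_one_div_add_atTop_nhds_zero_nat
  have hsup : ∀ k x, R + 1 < ‖x‖ → moll (hk k) v x = 0 := fun k x hx =>
    moll_supp (hkp k) hs x (by linarith [hk1 k])
  have hbd : ∀ k x, moll (hk k) v x ≤ M := by
    intro k x
    have := muE_prob N (hkp k)
    have := norm_integral_le_of_norm_le_const (μ := muE N (hk k)) (f := fun y => v (x - y)) (C := M)
      (Eventually.of_forall fun y => hM _)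
    simp at this
    exact (le_abs_self _).trans this
  have lim : ∀ x, Tendsto (fun k => moll (hk k) v x) atTop (𝓝 (v x)) := by
    intro x
    rw [Metric.tendsto_atTop']
    intro e he
    obtain ⟨d, hd, h⟩ := uc_of_ball hv hs (e / 2) (by positivity)
    obtain ⟨n, hn⟩ := (hk0.eventually (gt_mem_nhds hd)).exists_forall_of_atTop
    refine ⟨n, fun k hkn => ?_⟩
    rw [Real.dist_eq]
    have := moll_close (hkp k) hv hM (ε := e / 2) (fun a b hab => h a b (hab.trans (hn k hkn.le).le)) x
    linarith
  have T := dct_ball (R + 1) (M ^ q) (fk := fun k x => (moll (hk k) v x) ^ q) (f := fun x => v x ^ q)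
    (fun k => (moll_smooth (hkp k) hv).continuous.rpow_const fun _ => Or.inr hq.le)
    (fun k x hx => by rw [hsup k x hx, Real.zero_rpow hq.ne'])
    (fun k x => by
      have := moll_nonneg (δ := hk k) h0 x
      rw [abs_of_nonneg (Real.rpow_nonneg this _)]
      exact Real.rpow_le_rpow this (hbd k x) hq.le)
    (fun x => (lim x).rpow_const (Or.inr hq.le))
  obtain ⟨k, hk'⟩ := (T.eventually (lt_mem_nhds (sub_lt_self _ hε))).exists
  exact ⟨moll (hk k) v, moll_smooth (hkp k) hv, moll_nonneg h0, moll_radial (hkp k) hr, hsup k,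
    moll_KE (hkp k) hv hM, moll_sq (hkp k) hv, hk'⟩

noncomputable def chi {N : ℕ} (x : E N) : ℝ := Real.smoothTransition (2 - ‖x‖ ^ 2)

lemma chi_smooth {N : ℕ} : ContDiff ℝ (⊤ : ℕ∞) (chi (N := N)) := by
  unfold chi
  exact Real.smoothTransition.contDiff.comp (contDiff_const.sub (contDiff_norm_sq ℝ))

lemma chi_nonneg {N : ℕ} (x : E N) : 0 ≤ chi x := Real.smoothTransition.nonneg _
lemma chi_le {N : ℕ} (x : E N) : chi x ≤ 1 := Real.smoothTransition.le_one _
lemma chi_supp {N : ℕ} (x : E N) (hx : 2 < ‖x‖) : chi x = 0 := by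
  unfold chi; apply Real.smoothTransition.zero_of_nonpos; nlinarith
lemma chi_zero {N : ℕ} : chi (0 : E N) = 1 := by
  unfold chi; apply Real.smoothTransition.one_of_one_le; simp

lemma norm_grad {N : ℕ} (f : E N → ℝ) (x : E N) : ‖gradient f x‖ = ‖fderiv ℝ f x‖ := by
  unfold gradient; exact LinearIsometryEquiv.norm_map _ _

lemma chi_grad_bdd {N : ℕ} : ∃ C, ∀ x : E N, ‖fderiv ℝ chi x‖ ≤ C := by
  have hc : Continuous (fderiv ℝ (chi (N := N))) := chi_smooth.continuous_fderiv (by simp)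
  exact hc.bounded_above_of_compact_support (HasCompactSupport.fderiv ℝ (hcs_of_ball chi_supp))

noncomputable def trunc {N : ℕ} (k : ℕ) (ω : E N → ℝ) (x : E N) : ℝ :=
  chi ((1 / ((k : ℝ) + 1)) • x) * ω x

lemma trunc_fderiv {N : ℕ} (k : ℕ) {ω : E N → ℝ} (hω : Differentiable ℝ ω) (x : E N) :
    HasFDerivAt (trunc k ω)
      (chi ((1 / ((k : ℝ) + 1)) • x) • fderiv ℝ ω x +
        ω x • ((1 / ((k : ℝ) + 1)) • fderiv ℝ chi ((1 / ((k : ℝ) + 1)) • x))) x := by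
  set s := (1 / ((k : ℝ) + 1))
  have h1 : HasFDerivAt (fun x : E N => chi (s • x)) (s • fderiv ℝ chi (s • x)) x := by
    have hd : HasFDerivAt chi (fderiv ℝ chi (s • x)) (s • x) :=
      ((chi_smooth (N := N)).differentiable (by simp) (s • x)).hasFDerivAt
    have := hd.comp x ((hasFDerivAt_id x).const_smul s)
    have e : fderiv ℝ chi (s • x) ∘SL (s • ContinuousLinearMap.id ℝ (E N)) = s • fderiv ℝ chi (s • x) := by
      ext y; simp
    rw [e] at this
    exact this
  exact h1.mul (hω x).hasFDerivAt

lemma trunc_supp {N : ℕ} (k : ℕ) (ω : E N → ℝ) (x : E N) (hx : 2 * ((k : ℝ) + 1) < ‖x‖) :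
    trunc k ω x = 0 := by
  unfold trunc
  rw [chi_supp, zero_mul]
  rw [norm_smul, Real.norm_eq_abs, abs_of_pos (by positivity), one_div, ← div_eq_inv_mul, lt_div_iff₀ (by positivity)]
  exact hx

lemma sq_int_grad {N : ℕ} {ω : E N → ℝ} (h : MemLp (fun x => gradient ω x) 2 volume) :
    Integrable fun x => ‖gradient ω x‖ ^ 2 := by
  have := h.norm
  exact (memLp_two_iff_integrable_sq this.1).1 this

lemma sk_tendsto : Tendsto (fun k : ℕ => 1 / ((k : ℝ) + 1)) atTop (𝓝 0) :=
  tendsto_one_div_add_atTop_nhds_zero_nat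

lemma chi_sk {N : ℕ} (x : E N) : Tendsto (fun k : ℕ => chi ((1 / ((k : ℝ) + 1)) • x)) atTop (𝓝 1) := by
  have h1 : Tendsto (fun k : ℕ => (1 / ((k : ℝ) + 1)) • x) atTop (𝓝 ((0:ℝ) • x)) := sk_tendsto.smul_const x
  rw [zero_smul] at h1
  have := ((chi_smooth (N := N)).continuous.tendsto 0).comp h1
  rwa [chi_zero] at this

lemma trunc_grad_bd {N : ℕ} {C : ℝ} (hC : ∀ x : E N, ‖fderiv ℝ chi x‖ ≤ C) (k : ℕ) {ω : E N → ℝ}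
    (hω : Differentiable ℝ ω) (x : E N) :
    ‖gradient (trunc k ω) x‖ ^ 2 ≤ 2 * ‖gradient ω x‖ ^ 2 + 2 * C ^ 2 * ω x ^ 2 := by
  rw [norm_grad, norm_grad, (trunc_fderiv k hω x).fderiv]
  set s := (1 / ((k : ℝ) + 1)) with hs
  have hs0 : 0 ≤ s := by positivity
  have hs1 : s ≤ 1 := by rw [hs, div_le_one (by positivity)]; linarith [(Nat.cast_nonneg k : (0:ℝ) ≤ k)]
  have h1 := norm_add_le (chi (s • x) • fderiv ℝ ω x) (ω x • (s • fderiv ℝ chi (s • x)))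
  rw [norm_smul, norm_smul, norm_smul, Real.norm_eq_abs, Real.norm_eq_abs, Real.norm_eq_abs,
    abs_of_nonneg (chi_nonneg _), abs_of_nonneg hs0] at h1
  have h2 : chi (s • x) * ‖fderiv ℝ ω x‖ ≤ ‖fderiv ℝ ω x‖ := by
    have := chi_le (s • x); nlinarith [norm_nonneg (fderiv ℝ ω x)]
  have h3 : s * ‖fderiv ℝ chi (s • x)‖ ≤ C := by
    have := hC (s • x)
    nlinarith [norm_nonneg (fderiv ℝ chi (s • x))]
  have h4 : |ω x| * (s * ‖fderiv ℝ chi (s • x)‖) ≤ |ω x| * C := by gcongr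
  have h5 : ‖chi (s • x) • fderiv ℝ ω x + ω x • (s • fderiv ℝ chi (s • x))‖ ≤ ‖fderiv ℝ ω x‖ + |ω x| * C := by
    linarith
  have h6 : ‖chi (s • x) • fderiv ℝ ω x + ω x • (s • fderiv ℝ chi (s • x))‖ ^ 2 ≤
    (‖fderiv ℝ ω x‖ + |ω x| * C) ^ 2 := by gcongr
  have h7 := sq_nonneg (‖fderiv ℝ ω x‖ - |ω x| * C)
  have h8 := sq_abs (ω x)
  nlinarith

lemma trunc_grad_lim {N : ℕ} {C : ℝ} (hC : ∀ x : E N, ‖fderiv ℝ chi x‖ ≤ C) {ω : E N → ℝ}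
    (hω : Differentiable ℝ ω) (x : E N) :
    Tendsto (fun k => ‖gradient (trunc k ω) x‖ ^ 2) atTop (𝓝 (‖gradient ω x‖ ^ 2)) := by
  simp_rw [norm_grad, fun k => (trunc_fderiv k hω x).fderiv]
  apply Tendsto.pow
  apply Tendsto.norm
  have h1 := (chi_sk x).smul_const (fderiv ℝ ω x)
  have h2 : Tendsto (fun k : ℕ => (1 / ((k : ℝ) + 1)) • fderiv ℝ chi ((1 / ((k : ℝ) + 1)) • x)) atTop (𝓝 0) := by
    apply squeeze_zero_norm (a := fun k : ℕ => (1 / ((k : ℝ) + 1)) * C)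
    · intro k
      rw [norm_smul, Real.norm_eq_abs, abs_of_nonneg (by positivity)]
      have := hC ((1 / ((k : ℝ) + 1)) • x)
      gcongr
    · simpa using sk_tendsto.mul_const C
  have h3 := h1.add (h2.const_smul (ω x))
  simpa using h3

lemma grad_sq_int_smooth {N : ℕ} {w : E N → ℝ} (ws : ContDiff ℝ (⊤ : ℕ∞) w) {R : ℝ}
    (wsup : ∀ x, R < ‖x‖ → w x = 0) : Integrable fun x => ‖gradient w x‖ ^ 2 := by
  have hc : Continuous (fderiv ℝ w) := ws.continuous_fderiv (by simp)
  have hs : HasCompactSupport (fderiv ℝ w) := HasCompactSupport.fderiv ℝ (hcs_of_ball wsup)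
  have h1 : HasCompactSupport fun x => ‖fderiv ℝ w x‖ ^ 2 := by
    have := hs.norm.comp_left (g := fun t : ℝ => t ^ 2) (by simp)
    exact this
  have h2 : (fun x => ‖gradient w x‖ ^ 2) = fun x => ‖fderiv ℝ w x‖ ^ 2 := by
    funext x; rw [norm_grad]
  rw [h2]
  exact (hc.norm.pow 2).integrable_of_hasCompactSupport h1

lemma radial_approx {N : ℕ} (hN : 0 < N) {q : ℝ} (hq : 1 < q) {ω : E N → ℝ} (hω : MemH1 N ω)
    (hi : Integrable fun x => |ω x| ^ q) {ε : ℝ} (hε : 0 < ε) :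
    ∃ w : E N → ℝ, ContDiff ℝ (⊤ : ℕ∞) w ∧ (∀ x, 0 ≤ w x) ∧ Radial N w ∧
      (∃ ρ : ℝ, 0 < ρ ∧ ∀ x, ρ < ‖x‖ → w x = 0) ∧
      ∫ x, ‖gradient w x‖ ^ 2 ≤ (∫ x, ‖gradient ω x‖ ^ 2) + ε ∧
      ∫ x, w x ^ 2 ≤ (∫ x, ω x ^ 2) + ε ∧
      (∫ x, |ω x| ^ q) - ε < ∫ x, |w x| ^ q := by
  obtain ⟨hd, h2, hg⟩ := hω
  obtain ⟨C, hC⟩ := chi_grad_bdd (N := N)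
  have hq0 : 0 < q := by linarith
  have ωc := hd.continuous
  have i2 : Integrable fun x => ω x ^ 2 := (memLp_two_iff_integrable_sq h2.1).1 h2
  have ig := sq_int_grad hg
  have fd : ∀ k, Differentiable ℝ (trunc k ω) := fun k x => (trunc_fderiv k hd x).differentiableAt
  have tl : ∀ x, Tendsto (fun k => trunc k ω x) atTop (𝓝 (ω x)) := fun x => by
    simpa [trunc] using (chi_sk x).mul_const (ω x)
  have tb : ∀ k x, |trunc k ω x| ≤ |ω x| := fun k x => by
    unfold trunc
    rw [abs_mul, abs_of_nonneg (chi_nonneg _)]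
    have := chi_le ((1 / ((k : ℝ) + 1)) • x)
    nlinarith [abs_nonneg (ω x)]
  have bint : Integrable fun x => 2 * ‖gradient ω x‖ ^ 2 + 2 * C ^ 2 * ω x ^ 2 :=
    (ig.const_mul 2).add (i2.const_mul _)
  have gm : ∀ k, AEStronglyMeasurable (fun x => ‖gradient (trunc k ω) x‖ ^ 2) volume := fun k =>
    ((grad_meas (trunc k ω)).norm.pow_const 2).aestronglyMeasurable
  have L1 : Tendsto (fun k => ∫ x, ‖gradient (trunc k ω) x‖ ^ 2) atTop (𝓝 (∫ x, ‖gradient ω x‖ ^ 2)) := by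
    apply tendsto_integral_of_dominated_convergence _ gm bint
    · intro k
      refine Eventually.of_forall fun x => ?_
      rw [Real.norm_eq_abs, abs_of_nonneg (sq_nonneg _)]
      exact trunc_grad_bd hC k hd x
    · exact Eventually.of_forall fun x => trunc_grad_lim hC hd x
  have L2 : Tendsto (fun k => ∫ x, (trunc k ω x) ^ 2) atTop (𝓝 (∫ x, ω x ^ 2)) := by
    apply tendsto_integral_of_dominated_convergence _ (fun k => ((fd k).continuous.pow 2).aestronglyMeasurable) i2
    · intro k
      refine Eventually.of_forall fun x => ?_
      rw [Real.norm_eq_abs, abs_of_nonneg (sq_nonneg _)]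
      exact sq_le_sq.2 (tb k x)
    · exact Eventually.of_forall fun x => (tl x).pow 2
  have L3 : Tendsto (fun k => ∫ x, |trunc k ω x| ^ q) atTop (𝓝 (∫ x, |ω x| ^ q)) := by
    apply tendsto_integral_of_dominated_convergence _
      (fun k => ((fd k).continuous.abs.rpow_const fun _ => Or.inr hq0.le).aestronglyMeasurable) hi
    · intro k
      refine Eventually.of_forall fun x => ?_
      rw [Real.norm_eq_abs, abs_of_nonneg (Real.rpow_nonneg (abs_nonneg _) _)]
      exact Real.rpow_le_rpow (abs_nonneg _) (tb k x) hq0.le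
    · exact Eventually.of_forall fun x => (tl x).abs.rpow_const (Or.inr hq0.le)
  obtain ⟨k, ⟨k1, k2⟩, k3⟩ := (((L1.eventually (gt_mem_nhds (lt_add_of_pos_right _ hε))).and
    (L2.eventually (gt_mem_nhds (lt_add_of_pos_right _ hε)))).and
    (L3.eventually (lt_mem_nhds (sub_lt_self _ (half_pos hε))))).exists
  set f := trunc k ω with hf
  have fc : Continuous f := (fd k).continuous
  have fs : ∀ x, 2 * ((k : ℝ) + 1) < ‖x‖ → f x = 0 := trunc_supp k ω
  set R := 2 * ((k : ℝ) + 1) with hR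
  have us : ∀ x, R < ‖x‖ → |f x| = 0 := fun x hx => by rw [fs x hx, abs_zero]
  obtain ⟨v, hv, vc, vr⟩ := exists_radial fc.abs (fun x => abs_nonneg _) us
  obtain ⟨w, ws, w0, wr, wsup, wK, w2, wq⟩ := exists_moll hq0 vc hv.nonneg vr hv.supp (half_pos hε)
  have fgi : Integrable fun x => ‖gradient f x‖ ^ 2 := by
    refine bint.mono' (gm k) (Eventually.of_forall fun x => ?_)
    rw [Real.norm_eq_abs, abs_of_nonneg (sq_nonneg _)]
    exact trunc_grad_bd hC k hd x
  have wd : Differentiable ℝ w := ws.differentiable (by simp)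
  have wgi : Integrable fun x => ‖gradient w x‖ ^ 2 := by
    exact grad_sq_int_smooth ws wsup
  obtain ⟨e0, he0⟩ : ∃ e0 : E N, ‖e0‖ = 1 := ⟨EuclideanSpace.single ⟨0, hN⟩ 1, by simp⟩
  refine ⟨w, ws, w0, wr, ⟨R + 1, by positivity, wsup⟩, ?_, ?_, ?_⟩
  · have := grad_le_of_KE wd he0 (M := ∫⁻ x, ENNReal.ofReal (‖gradient f x‖ ^ 2)) (fun h hh =>
      (wK h).trans ((hv.ke h).trans ((KE_abs h f).trans (KE_le (fd k) h he0))))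
    rw [← ofReal_integral_eq_lintegral_ofReal wgi (Eventually.of_forall fun x => sq_nonneg _),
      ← ofReal_integral_eq_lintegral_ofReal fgi (Eventually.of_forall fun x => sq_nonneg _),
      ENNReal.ofReal_le_ofReal_iff (integral_nonneg fun x => sq_nonneg _)] at this
    linarith
  · have a1 : Integrable fun x => w x ^ 2 := integrable_of_ball (ws.continuous.pow 2) (R := R + 1)
      fun x hx => by rw [wsup x hx]; simp
    have a2 : Integrable fun x => v x ^ 2 := integrable_of_ball (vc.pow 2) (R := R)
      fun x hx => by rw [hv.supp x hx]; simp
    rw [← ofReal_integral_eq_lintegral_ofReal a1 (Eventually.of_forall fun x => sq_nonneg _),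
      ← ofReal_integral_eq_lintegral_ofReal a2 (Eventually.of_forall fun x => sq_nonneg _),
      ENNReal.ofReal_le_ofReal_iff (integral_nonneg fun x => sq_nonneg _)] at w2
    have := hv.int (fun t => t ^ 2) (by fun_prop) (by simp)
    simp only [sq_abs] at this
    linarith
  · have := hv.int (fun t => |t| ^ q) (continuous_abs.rpow_const fun _ => Or.inr hq0.le)
      (by simp [hq0.ne'])
    simp only [abs_abs] at this
    simp_rw [fun x => abs_of_nonneg (hv.nonneg x)] at this
    simp_rw [fun x => abs_of_nonneg (w0 x)]
    linarith

noncomputable def Pt (N : ℕ) (γ : ℝ) : E N :=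
  WithLp.toLp 2 fun i => if (i : ℕ) = 0 then Real.cos γ else if (i : ℕ) = 1 then Real.sin γ else 0

lemma act_sub (N : ℕ) (hN : 2 ≤ N) (α : ℝ)
    (θ : EuclideanSpace ℝ (Fin (N - 2)) ≃ₗᵢ[ℝ] EuclideanSpace ℝ (Fin (N - 2))) (x y : E N) :
    act N hN α θ (x - y) = act N hN α θ x - act N hN α θ y := by
  ext i
  unfold act
  simp only [PiLp.sub_apply]
  split_ifs with h0 h1
  · ring
  · ring
  · rw [← PiLp.sub_apply, ← map_sub]
    rfl

lemma act_norm (N : ℕ) (hN : 2 ≤ N) (α : ℝ)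
    (θ : EuclideanSpace ℝ (Fin (N - 2)) ≃ₗᵢ[ℝ] EuclideanSpace ℝ (Fin (N - 2))) (x : E N) :
    ‖act N hN α θ x‖ = ‖x‖ := by
  obtain ⟨m, rfl⟩ : ∃ m, N = m + 2 := ⟨N - 2, by omega⟩
  have key : ‖act (m + 2) hN α θ x‖ ^ 2 = ‖x‖ ^ 2 := by
    have hθ := θ.norm_map (WithLp.toLp 2 fun j : Fin (m + 2 - 2) => x ⟨(j : ℕ) + 2, by have := j.isLt; omega⟩)
    have hθ2 := congrArg (fun t => t ^ 2) hθ
    simp only at hθ2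
    rw [EuclideanSpace.real_norm_sq_eq, EuclideanSpace.real_norm_sq_eq] at hθ2
    rw [EuclideanSpace.real_norm_sq_eq, EuclideanSpace.real_norm_sq_eq,
      Fin.sum_univ_succ, Fin.sum_univ_succ, Fin.sum_univ_succ (n := m + 1), Fin.sum_univ_succ (n := m)]
    have e1 : ∀ i : Fin m, (act (m + 2) hN α θ x) i.succ.succ =
      θ (WithLp.toLp 2 fun j : Fin (m + 2 - 2) => x ⟨(j : ℕ) + 2, by have := j.isLt; omega⟩) i := by
      intro i; unfold act; simp
    have e2 : (act (m + 2) hN α θ x) 0 = Real.cos α * x 0 - Real.sin α * x 1 := by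
      unfold act; simp
    have e3 : (act (m + 2) hN α θ x) (Fin.succ 0) = Real.sin α * x 0 + Real.cos α * x 1 := by
      unfold act; simp
    simp_rw [e1]
    rw [e2, e3]
    have hθ3 : ∑ i : Fin m, (θ (WithLp.toLp 2 fun j : Fin (m + 2 - 2) => x ⟨(j : ℕ) + 2, by have := j.isLt; omega⟩) i) ^ 2
      = ∑ i : Fin m, x i.succ.succ ^ 2 := hθ2
    rw [hθ3]
    have : x (Fin.succ 0) = x 1 := rfl
    rw [this]
    have := Real.sin_sq_add_cos_sq α
    linear_combination (x 0 ^ 2 + x 1 ^ 2) * this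
  exact (sq_eq_sq₀ (norm_nonneg _) (norm_nonneg _)).1 key

lemma act_Pt (N : ℕ) (hN : 2 ≤ N) (α : ℝ)
    (θ : EuclideanSpace ℝ (Fin (N - 2)) ≃ₗᵢ[ℝ] EuclideanSpace ℝ (Fin (N - 2))) (R γ : ℝ) :
    act N hN α θ (R • Pt N γ) = R • Pt N (γ + α) := by
  ext i
  unfold act
  simp only
  split_ifs with h0 h1
  · simp only [Pt, PiLp.smul_apply, smul_eq_mul, Real.cos_add]
    simp [h0]; ring
  · simp only [Pt, PiLp.smul_apply, smul_eq_mul, Real.sin_add]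
    simp [h1]; ring
  · simp only [Pt, PiLp.smul_apply, smul_eq_mul]
    simp [h0, h1]
    have : (WithLp.toLp 2 fun _ : Fin (N - 2) => (0:ℝ)) = 0 := rfl
    rw [this]; simp

lemma Pt_norm (N : ℕ) (hN : 2 ≤ N) (γ : ℝ) : ‖Pt N γ‖ = 1 := by
  obtain ⟨m, rfl⟩ : ∃ m, N = m + 2 := ⟨N - 2, by omega⟩
  have : ‖Pt (m + 2) γ‖ ^ 2 = 1 := by
    rw [EuclideanSpace.real_norm_sq_eq, Fin.sum_univ_succ, Fin.sum_univ_succ]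
    simp [Pt]
  nlinarith [norm_nonneg (Pt (m + 2) γ)]

lemma Pt_per (N : ℕ) (γ : ℝ) : Pt N (γ + 2 * π) = Pt N γ := by
  unfold Pt; simp

lemma Pt_inj (N : ℕ) (hN : 2 ≤ N) {γ γ' : ℝ} (h : Pt N γ = Pt N γ') :
    ∃ k : ℤ, γ - γ' = 2 * π * k := by
  have h0 := congrArg (fun v : E N => v ⟨0, by omega⟩) h
  have h1 := congrArg (fun v : E N => v ⟨1, by omega⟩) h
  simp [Pt] at h0 h1
  exact Real.Angle.angle_eq_iff_two_pi_dvd_sub.1 (Real.Angle.cos_sin_inj h0 h1)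

lemma w_act (N : ℕ) (hN : 2 ≤ N) {w : E N → ℝ} (hw : Radial N w) (α : ℝ)
    (θ : EuclideanSpace ℝ (Fin (N - 2)) ≃ₗᵢ[ℝ] EuclideanSpace ℝ (Fin (N - 2))) (x : E N) (R γ : ℝ) :
    w (act N hN α θ x - R • Pt N γ) = w (x - R • Pt N (γ - α)) := by
  apply hw
  have : R • Pt N γ = act N hN α θ (R • Pt N (γ - α)) := by rw [act_Pt]; simp
  rw [this, ← act_sub, act_norm]

/-- angle of the `j`-th bump of the `i`-th component -/
noncomputable def ang (ℓ n i j : ℕ) : ℝ := 2 * π * j / n - 2 * π * i / (ℓ * n)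

lemma ang_inj (N ℓ n : ℕ) (hN : 2 ≤ N) (hℓ : 0 < ℓ) (hn : 0 < n) {i j i' j' : ℕ} (hi : i < ℓ) (hi' : i' < ℓ)
    (hj : j < n) (hj' : j' < n) (h : Pt N (ang ℓ n i j) = Pt N (ang ℓ n i' j')) : i = i' ∧ j = j' := by
  obtain ⟨k, hk⟩ := Pt_inj N hN h
  unfold ang at hk
  have l0 : (ℓ : ℝ) ≠ 0 := by positivity
  have n0 : (n : ℝ) ≠ 0 := by positivity
  have p0 := Real.pi_ne_zero
  have e : (j : ℝ) * ℓ - i - (j' * ℓ - i') = k * (ℓ * n) := by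
    field_simp at hk
    nlinarith
  have e' : (j : ℤ) * ℓ - i - (j' * ℓ - i') = k * (ℓ * n) := by exact_mod_cast e
  have e2 : (ℓ : ℤ) * (j - j' - k * n) = i - i' := by linear_combination e'
  have hz : (j : ℤ) - j' - k * n = 0 := by
    by_contra hne
    rcases lt_or_gt_of_ne hne with h1 | h1
    · have : (ℓ : ℤ) * (j - j' - k * n) ≤ ℓ * (-1) := by
        apply mul_le_mul_of_nonneg_left <;> omega
      omega
    · have : (ℓ : ℤ) * 1 ≤ ℓ * (j - j' - k * n) := by
        apply mul_le_mul_of_nonneg_left <;> omega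
      omega
  have hi2 : i = i' := by rw [hz] at e2; omega
  refine ⟨hi2, ?_⟩
  have hk0 : k = 0 := by
    by_contra hne
    rcases lt_or_gt_of_ne hne with h1 | h1
    · have : k * n ≤ (-1) * (n : ℤ) := by
        apply mul_le_mul_of_nonneg_right <;> omega
      omega
    · have : 1 * (n : ℤ) ≤ k * n := by
        apply mul_le_mul_of_nonneg_right <;> omega
      omega
  rw [hk0] at hz; omega

noncomputable def uB (N ℓ n : ℕ) (w : E N → ℝ) (R t : ℝ) (i : Fin ℓ) (x : E N) : ℝ :=
  t * ∑ j ∈ Finset.range n, w (x - R • Pt N (ang ℓ n i j))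

lemma uB_pin (N ℓ n : ℕ) (hN : 2 ≤ N) (hℓ : 0 < ℓ) (hn : 0 < n) {w : E N → ℝ} (hw : Radial N w)
    (R t : ℝ) : Pinwheel N hN n ℓ hℓ (uB N ℓ n w R t) := by
  have n0 : (n : ℝ) ≠ 0 := by positivity
  have l0 : (ℓ : ℝ) ≠ 0 := by positivity
  constructor
  · intro θ x
    unfold uB
    congr 1
    simp_rw [w_act N hN hw]
    obtain ⟨m, rfl⟩ : ∃ m, n = m + 1 := ⟨n - 1, by omega⟩
    rw [Finset.sum_range_succ', Finset.sum_range_succ]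
    congr 1
    · apply Finset.sum_congr rfl
      intro j _
      congr 4
      unfold ang; push_cast; field_simp; ring
    · rw [← Pt_per]
      congr 4
      unfold ang; push_cast; field_simp; ring
  · intro j x
    unfold uB
    congr 1
    simp_rw [w_act N hN hw]
    apply Finset.sum_congr rfl
    intro k _
    congr 4
    unfold ang; simp

lemma sum_disj {ι A B : Type*} [AddCommMonoid A] [AddCommMonoid B] (S : Finset ι) (b : ι → A)
    (G : A → B) (hG : G 0 = 0) (h : ∀ j ∈ S, ∀ k ∈ S, j ≠ k → b j = 0 ∨ b k = 0) :
    G (∑ j ∈ S, b j) = ∑ j ∈ S, G (b j) := by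
  by_cases hall : ∀ j ∈ S, b j = 0
  · rw [Finset.sum_eq_zero hall, hG, Finset.sum_eq_zero]
    intro j hj; rw [hall j hj, hG]
  · push Not at hall
    obtain ⟨j0, hj0, hne⟩ := hall
    have : ∀ k ∈ S, k ≠ j0 → b k = 0 := fun k hk hkj => (h k hk j0 hj0 hkj).resolve_right hne
    rw [Finset.sum_eq_single_of_mem j0 hj0 this, Finset.sum_eq_single_of_mem j0 hj0]
    intro k hk hkj; rw [this k hk hkj, hG]

lemma grad_zero {N : ℕ} {w : E N → ℝ} {ρ : ℝ} (hs : ∀ x, ρ < ‖x‖ → w x = 0) (x : E N) (hx : ρ < ‖x‖) :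
    gradient w x = 0 := by
  have : w =ᶠ[𝓝 x] fun _ => 0 := by
    filter_upwards [(isOpen_lt continuous_const continuous_norm).mem_nhds hx] with y hy
    exact hs y hy
  rw [this.gradient_eq]; simp

/-- generic sum of bumps -/
noncomputable def bsum {N : ℕ} (n : ℕ) (w : E N → ℝ) (a : ℕ → E N) (t : ℝ) (x : E N) : ℝ :=
  t * ∑ j ∈ Finset.range n, w (x - a j)

lemma bsum_smooth {N : ℕ} (n : ℕ) {w : E N → ℝ} (hw : ContDiff ℝ (⊤ : ℕ∞) w) (a : ℕ → E N) (t : ℝ) :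
    ContDiff ℝ (⊤ : ℕ∞) (bsum n w a t) := by
  unfold bsum
  exact contDiff_const.mul (ContDiff.sum fun j _ => hw.comp (contDiff_id.sub contDiff_const))

lemma bsum_grad {N : ℕ} (n : ℕ) {w : E N → ℝ} (hw : Differentiable ℝ w) (a : ℕ → E N) (t : ℝ) (x : E N) :
    gradient (bsum n w a t) x = t • ∑ j ∈ Finset.range n, gradient w (x - a j) := by
  apply HasGradientAt.gradient
  rw [hasGradientAt_iff_hasFDerivAt]
  have h1 : ∀ j, HasFDerivAt (fun x => w (x - a j)) (fderiv ℝ w (x - a j)) x := fun j =>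
    (hasFDerivAt_comp_sub (a j)).2 (hw (x - a j)).hasFDerivAt
  have h2 := (HasFDerivAt.fun_sum (u := Finset.range n) fun j _ => h1 j).const_mul t
  have e : (InnerProductSpace.toDual ℝ (E N)) (t • ∑ j ∈ Finset.range n, gradient w (x - a j)) =
      t • ∑ j ∈ Finset.range n, fderiv ℝ w (x - a j) := by
    rw [map_smul, map_sum]
    simp_rw [toDual_gradient]
  rw [e]
  exact h2

structure BSep {N : ℕ} (n : ℕ) (a : ℕ → E N) (ρ : ℝ) : Prop where
  sep : ∀ j < n, ∀ k < n, j ≠ k → 2 * ρ < ‖a j - a k‖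

lemma sep_or {N : ℕ} {ρ : ℝ} {a b : E N} (h : 2 * ρ < ‖a - b‖) (x : E N) : ρ < ‖x - a‖ ∨ ρ < ‖x - b‖ := by
  by_contra hc
  push Not at hc
  have : ‖a - b‖ ≤ ‖x - b‖ + ‖x - a‖ := by
    have := norm_sub_le (x - b) (x - a)
    simpa using this
  linarith

lemma bsum_comp {N n : ℕ} {w : E N → ℝ} {ρ : ℝ} (hs : ∀ x, ρ < ‖x‖ → w x = 0) {a : ℕ → E N}
    (ha : BSep n a ρ) (t : ℝ) (G : ℝ → ℝ) (hG : G 0 = 0) (x : E N) :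
    G (bsum n w a t x) = ∑ j ∈ Finset.range n, G (t * w (x - a j)) := by
  unfold bsum
  rw [Finset.mul_sum]
  apply sum_disj _ _ _ hG
  intro j hj k hk hjk
  rcases sep_or (ha.sep j (Finset.mem_range.1 hj) k (Finset.mem_range.1 hk) hjk) x with h | h
  · left; rw [hs _ h, mul_zero]
  · right; rw [hs _ h, mul_zero]

lemma bsum_gradsq {N n : ℕ} {w : E N → ℝ} (hw : Differentiable ℝ w) {ρ : ℝ} (hs : ∀ x, ρ < ‖x‖ → w x = 0)
    {a : ℕ → E N} (ha : BSep n a ρ) (t : ℝ) (x : E N) :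
    ‖gradient (bsum n w a t) x‖ ^ 2 = ∑ j ∈ Finset.range n, t ^ 2 * ‖gradient w (x - a j)‖ ^ 2 := by
  rw [bsum_grad n hw, norm_smul, mul_pow, ← Finset.mul_sum, Real.norm_eq_abs, sq_abs]
  congr 1
  apply sum_disj (G := fun v : E N => ‖v‖ ^ 2) _ _ (by simp)
  intro j hj k hk hjk
  rcases sep_or (ha.sep j (Finset.mem_range.1 hj) k (Finset.mem_range.1 hk) hjk) x with h | h
  · left; exact grad_zero hs _ h
  · right; exact grad_zero hs _ h

lemma bsum_supp {N n : ℕ} {w : E N → ℝ} {ρ : ℝ} (hs : ∀ x, ρ < ‖x‖ → w x = 0) {a : ℕ → E N} {R : ℝ}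
    (ha : ∀ j, ‖a j‖ ≤ R) (t : ℝ) (x : E N) (hx : R + ρ < ‖x‖) : bsum n w a t x = 0 := by
  unfold bsum
  rw [Finset.sum_eq_zero, mul_zero]
  intro j _
  apply hs
  have := norm_sub_norm_le x (a j)
  linarith [ha j]

lemma memH1_smooth {N : ℕ} {w : E N → ℝ} (ws : ContDiff ℝ (⊤ : ℕ∞) w) {R : ℝ}
    (wsup : ∀ x, R < ‖x‖ → w x = 0) : MemH1 N w := by
  refine ⟨ws.differentiable (by simp), ws.continuous.memLp_of_hasCompactSupport (hcs_of_ball wsup), ?_⟩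
  have := grad_sq_int_smooth ws wsup
  have h1 : MemLp (fun x => ‖gradient w x‖) 2 volume :=
    (memLp_two_iff_integrable_sq (grad_meas w).norm.aestronglyMeasurable).2 this
  exact (memLp_norm_iff (grad_meas w).aestronglyMeasurable).1 h1

/-- the one-bump norm -/
noncomputable def AV {N : ℕ} (V w : E N → ℝ) (a : E N) : ℝ :=
  ∫ y, (‖gradient w y‖ ^ 2 + V (y + a) * w y ^ 2)

lemma AV_int {N : ℕ} {V w : E N → ℝ} (hV : Continuous V) (ws : ContDiff ℝ (⊤ : ℕ∞) w) {R : ℝ}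
    (wsup : ∀ x, R < ‖x‖ → w x = 0) (a : E N) :
    Integrable fun y => ‖gradient w y‖ ^ 2 + V (y + a) * w y ^ 2 := by
  refine (grad_sq_int_smooth ws wsup).add ?_
  have := ws.continuous
  exact integrable_of_ball (by fun_prop) (R := R) fun x hx => by rw [wsup x hx]; ring

lemma AV_radial {N : ℕ} {V w : E N → ℝ} (hV : Continuous V) (hVr : Radial N V) (ws : ContDiff ℝ (⊤ : ℕ∞) w)
    {R : ℝ} (wsup : ∀ x, R < ‖x‖ → w x = 0) (hw : Radial N w) {a b : E N} (hab : ‖a‖ = ‖b‖) :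
    AV V w a = AV V w b := by
  unfold AV
  have wc := ws.continuous
  have i1 : ∀ a : E N, Integrable fun y => V (y + a) * w y ^ 2 := fun a =>
    integrable_of_ball (by fun_prop) (R := R) fun x hx => by rw [wsup x hx]; ring
  rw [integral_add (grad_sq_int_smooth ws wsup) (i1 a), integral_add (grad_sq_int_smooth ws wsup) (i1 b)]
  congr 1
  set L := (Submodule.reflection (ℝ ∙ (a - b))ᗮ) with hL
  have hLg : L a = b := Submodule.reflection_sub hab
  rw [← L.measurePreserving.integral_comp L.toHomeomorph.measurableEmbedding (fun y => V (y + b) * w y ^ 2)]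
  congr 1; funext y
  have e1 : w (L y) = w y := hw _ _ (L.norm_map y)
  have e2 : V (L y + b) = V (y + a) := by
    apply hVr; rw [← hLg, ← map_add, L.norm_map]
  rw [e1, e2]

lemma bsum_norm {N n : ℕ} {V w : E N → ℝ} (hV : Continuous V) (ws : ContDiff ℝ (⊤ : ℕ∞) w) {ρ : ℝ}
    (hs : ∀ x, ρ < ‖x‖ → w x = 0) {a : ℕ → E N} (ha : BSep n a ρ) (t : ℝ) :
    normVSq N V (bsum n w a t) = ∑ j ∈ Finset.range n, t ^ 2 * AV V w (a j) := by
  have hd : Differentiable ℝ w := ws.differentiable (by simp)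
  unfold normVSq
  have : ∀ x, ‖gradient (bsum n w a t) x‖ ^ 2 + V x * bsum n w a t x ^ 2 =
      ∑ j ∈ Finset.range n, t ^ 2 * (‖gradient w (x - a j)‖ ^ 2 + V ((x - a j) + a j) * w (x - a j) ^ 2) := by
    intro x
    rw [bsum_gradsq hd hs ha, bsum_comp hs ha t (fun s => s ^ 2) (by simp), Finset.mul_sum,
      ← Finset.sum_add_distrib]
    apply Finset.sum_congr rfl
    intro j _
    rw [sub_add_cancel]; ring
  simp_rw [this]
  have hi : ∀ j, Integrable fun x => (‖gradient w (x - a j)‖ ^ 2 + V ((x - a j) + a j) * w (x - a j) ^ 2) :=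
    fun j => (AV_int hV ws hs (a j)).comp_sub_right (a j)
  rw [integral_finsetSum _ fun j _ => (hi j).const_mul _]
  apply Finset.sum_congr rfl
  intro j _
  rw [integral_const_mul]
  congr 1
  exact integral_sub_right_eq_self (fun y => ‖gradient w y‖ ^ 2 + V (y + a j) * w y ^ 2) (a j)

lemma bsum_pow {N n : ℕ} {w : E N → ℝ} (wc : Continuous w) {ρ q : ℝ} (hq : 0 < q)
    (hs : ∀ x, ρ < ‖x‖ → w x = 0) {a : ℕ → E N} (ha : BSep n a ρ) {t : ℝ} (ht : 0 ≤ t) :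
    ∫ x, |bsum n w a t x| ^ q = n * (t ^ q * ∫ x, |w x| ^ q) := by
  simp_rw [fun x => bsum_comp hs ha t (fun s => |s| ^ q) (by simp [hq.ne']) x]
  have hi : Integrable fun x => |t * w x| ^ q :=
    integrable_of_ball ((continuous_const.mul wc).abs.rpow_const fun _ => Or.inr hq.le) (R := ρ)
      fun x hx => by rw [hs x hx]; simp [hq.ne']
  rw [integral_finsetSum _ fun j _ => hi.comp_sub_right (a j)]
  have : ∀ j, ∫ x, |t * w (x - a j)| ^ q = t ^ q * ∫ x, |w x| ^ q := by
    intro j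
    rw [integral_sub_right_eq_self (fun x => |t * w x| ^ q) (a j), ← integral_const_mul]
    congr 1; funext x
    rw [abs_mul, abs_of_nonneg ht, Real.mul_rpow ht (abs_nonneg _)]
  simp_rw [this]
  simp

lemma uB_eq (N ℓ n : ℕ) (w : E N → ℝ) (R t : ℝ) (i : Fin ℓ) :
    uB N ℓ n w R t i = bsum n w (fun j => R • Pt N (ang ℓ n i j)) t := rfl

lemma exists_sep (N ℓ n : ℕ) (hN : 2 ≤ N) (hℓ : 0 < ℓ) (hn : 0 < n) (ρ : ℝ) :
    ∀ᶠ R : ℝ in atTop, ∀ (i i' : Fin ℓ) (j j' : Fin n), (i, j) ≠ (i', j') →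
      2 * ρ < ‖R • Pt N (ang ℓ n i j) - R • Pt N (ang ℓ n i' j')‖ := by
  rw [eventually_all]; intro i
  rw [eventually_all]; intro i'
  rw [eventually_all]; intro j
  rw [eventually_all]; intro j'
  by_cases h : (i, j) = (i', j')
  · exact Eventually.of_forall fun R hne => absurd h hne
  have hne : Pt N (ang ℓ n i j) - Pt N (ang ℓ n i' j') ≠ 0 := by
    intro h0
    obtain ⟨h1, h2⟩ := ang_inj N ℓ n hN hℓ hn i.2 i'.2 j.2 j'.2 (sub_eq_zero.1 h0)
    exact h (Prod.ext (Fin.ext h1) (Fin.ext h2))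
  have hp : 0 < ‖Pt N (ang ℓ n i j) - Pt N (ang ℓ n i' j')‖ := norm_pos_iff.2 hne
  have := (tendsto_id.atTop_mul_const hp).eventually (eventually_gt_atTop (2 * ρ))
  filter_upwards [this, eventually_ge_atTop 0] with R hR hR0 _
  rw [← smul_sub, norm_smul, Real.norm_eq_abs, abs_of_nonneg hR0]
  exact hR

lemma energy_nehari {N : ℕ} (hN : 2 ≤ N) {ℓ n : ℕ} {hℓ : 0 < ℓ} {V : E N → ℝ} {β p : ℝ} (hp : 1 < p)
    {u : Fin ℓ → E N → ℝ} (h : InNehari N hN ℓ n hℓ V β p u)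
    (hK : ∑ i, ∑ j ∈ Finset.univ.erase i, ∫ x, |u i x| ^ p * |u j x| ^ p = 0) :
    energy N ℓ V β p u = (p - 1) / (2 * p) * ∑ i, normVSq N V (u i) := by
  have h1 : ∑ i, normVSq N V (u i) = (∑ i, (∫ x, |u i x| ^ (2 * p))) +
      β * ∑ i, ∑ j ∈ Finset.univ.erase i, ∫ x, |u i x| ^ p * |u j x| ^ p := by
    rw [Finset.mul_sum, ← Finset.sum_add_distrib]
    exact Finset.sum_congr rfl fun i _ => (h.2.2 i).2
  unfold energy
  rw [hK, mul_zero, add_zero] at h1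
  rw [hK, mul_zero]
  simp only [sub_zero]
  rw [← h1]
  have p0 : p ≠ 0 := by linarith
  field_simp

lemma not_int_const {N : ℕ} (hN : 2 ≤ N) {f : E N → ℝ} {c : ℝ} (hc : 0 < c) (hf : ∀ x, c ≤ f x) :
    ¬ Integrable f := by
  intro h
  have h1 : Integrable (fun _ : E N => c) := by
    refine h.mono' aestronglyMeasurable_const (Eventually.of_forall fun x => ?_)
    rw [Real.norm_eq_abs, abs_of_pos hc]; exact hf x
  have : Nonempty (Fin N) := ⟨⟨0, by omega⟩⟩
  have : NoncompactSpace (E N) := NormedSpace.noncompactSpace ℝ (E N)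
  rw [integrable_const_iff] at h1
  rcases h1 with h1 | h1
  · exact hc.ne' h1
  · have := h1.measure_univ_lt_top
    rw [measure_univ_of_isAddLeftInvariant] at this
    exact lt_irrefl _ this

lemma bdd_nehari {N : ℕ} (hN : 2 ≤ N) {ℓ n : ℕ} {hℓ : 0 < ℓ} {V : E N → ℝ} {β p : ℝ} (hp : 1 < p)
    (hβ : β < 0) (hV : ∀ x, 0 ≤ V x) :
    BddBelow (energy N ℓ V β p '' {u | InNehari N hN ℓ n hℓ V β p u}) := by
  refine ⟨0, ?_⟩
  rintro _ ⟨u, hu, rfl⟩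
  have hs : 0 ≤ ∑ i, normVSq N V (u i) := by
    apply Finset.sum_nonneg
    intro i _
    apply integral_nonneg
    intro x
    have := hV x
    positivity
  by_cases hK : ∑ i, ∑ j ∈ Finset.univ.erase i, ∫ x, |u i x| ^ p * |u j x| ^ p = 0
  · rw [energy_nehari hN hp hu hK]
    apply mul_nonneg _ hs
    apply div_nonneg <;> linarith
  · have hK0 : 0 ≤ ∑ i, ∑ j ∈ Finset.univ.erase i, ∫ x, |u i x| ^ p * |u j x| ^ p :=
      Finset.sum_nonneg fun i _ => Finset.sum_nonneg fun j _ => integral_nonneg fun x => by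
        positivity
    have hKp := lt_of_le_of_ne hK0 (Ne.symm hK)
    unfold energy
    rw [Finset.sum_eq_zero (s := Finset.univ) (f := fun i => ∫ x, (|u i x| ^ (2 * p) - _))]
    · linarith
    · intro i _
      apply integral_undef
      refine not_int_const hN (c := -(β / (2 * p) *
        ∑ i, ∑ j ∈ Finset.univ.erase i, ∫ x, |u i x| ^ p * |u j x| ^ p)) ?_ ?_
      · rw [neg_pos]
        exact mul_neg_of_neg_of_pos (div_neg_of_neg_of_pos hβ (by linarith)) hKp
      · intro x
        have : 0 ≤ |u i x| ^ (2 * p) := by positivity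
        linarith

lemma nehari_bump {N : ℕ} (hN : 2 ≤ N) {ℓ n : ℕ} (hℓ : 0 < ℓ) (hn : 0 < n) {V : E N → ℝ} {β p : ℝ} (hp : 1 < p)
    (hβ : β < 0) (hV : Continuous V) (hVr : Radial N V) (hV0 : ∀ x, 0 ≤ V x) {w : E N → ℝ} (ws : ContDiff ℝ (⊤ : ℕ∞) w)
    (wr : Radial N w) {ρ : ℝ} (hs : ∀ x, ρ < ‖x‖ → w x = 0)
    (hB : 0 < ∫ x, |w x| ^ (2 * p)) {R : ℝ} (hR0 : 0 ≤ R)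
    (hR : ∀ (i i' : Fin ℓ) (j j' : Fin n), (i, j) ≠ (i', j') →
      2 * ρ < ‖R • Pt N (ang ℓ n i j) - R • Pt N (ang ℓ n i' j')‖)
    {A : ℝ} (hA : A = AV V w (R • Pt N 0)) (hA0 : 0 < A) :
    cPhi N hN ℓ n hℓ V β p ≤ (ℓ : ℝ) * n * ((p - 1) / (2 * p) *
      ((A / ∫ x, |w x| ^ (2 * p)) ^ (1 / (p - 1)) * A)) := by
  set B := ∫ x, |w x| ^ (2 * p) with hBdef
  set t : ℝ := (A / B) ^ (1 / (2 * (p - 1))) with ht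
  have hAB : 0 < A / B := div_pos hA0 hB
  have tp : 0 < t := Real.rpow_pos_of_pos hAB _
  have t2 : t ^ 2 = (A / B) ^ (1 / (p - 1)) := by
    rw [ht, ← Real.rpow_natCast, ← Real.rpow_mul hAB.le]
    congr 1; push_cast
    have : p - 1 ≠ 0 := by linarith
    field_simp
  have t2p : t ^ (2 * p) * B = t ^ 2 * A := by
    have e : t ^ (2 * p) = t ^ 2 * (A / B) := by
      have : 2 * p = (2 : ℕ) + 2 * (p - 1) := by push_cast; ring
      rw [this, Real.rpow_add tp, Real.rpow_natCast]
      congr 1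
      rw [ht, ← Real.rpow_mul hAB.le]
      have : 1 / (2 * (p - 1)) * (2 * (p - 1)) = 1 := by
        have : p - 1 ≠ 0 := by linarith
        field_simp
      rw [this, Real.rpow_one]
    rw [e]; field_simp
  have hsep : ∀ i : Fin ℓ, BSep n (fun j => R • Pt N (ang ℓ n i j)) ρ := fun i =>
    ⟨fun j hj k hk hjk => hR i i ⟨j, hj⟩ ⟨k, hk⟩ (by simpa using hjk)⟩
  have hpn : ∀ γ, ‖R • Pt N γ‖ = R := fun γ => by
    rw [norm_smul, Pt_norm N hN, Real.norm_eq_abs, abs_of_nonneg hR0, mul_one]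
  have hAV : ∀ γ, AV V w (R • Pt N γ) = A := fun γ => by
    rw [hA]; exact AV_radial hV hVr ws hs wr (by rw [hpn, hpn])
  have hnorm : ∀ i, normVSq N V (uB N ℓ n w R t i) = n * (t ^ 2 * A) := by
    intro i
    rw [uB_eq, bsum_norm hV ws hs (hsep i)]
    simp [hAV]
  have hpow : ∀ i, ∫ x, |uB N ℓ n w R t i x| ^ (2 * p) = n * (t ^ (2 * p) * B) := by
    intro i
    rw [uB_eq, bsum_pow ws.continuous (by linarith) hs (hsep i) tp.le]
  have hint : ∀ i k, k ≠ i → ∫ x, |uB N ℓ n w R t i x| ^ p * |uB N ℓ n w R t k x| ^ p = 0 := by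
    intro i k hik
    rw [← integral_zero (E N) ℝ]
    congr 1; funext x
    have : uB N ℓ n w R t i x = 0 ∨ uB N ℓ n w R t k x = 0 := by
      by_contra hc
      push Not at hc
      obtain ⟨h1, h2⟩ := hc
      unfold uB at h1 h2
      obtain ⟨j, hj, hj1⟩ := Finset.exists_ne_zero_of_sum_ne_zero (right_ne_zero_of_mul h1)
      obtain ⟨j', hj', hj1'⟩ := Finset.exists_ne_zero_of_sum_ne_zero (right_ne_zero_of_mul h2)
      rcases sep_or (hR i k ⟨j, Finset.mem_range.1 hj⟩ ⟨j', Finset.mem_range.1 hj'⟩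
        (by intro h; exact hik (Prod.ext_iff.1 h).1.symm)) x with h | h
      · exact hj1 (hs _ h)
      · exact hj1' (hs _ h)
    have p0 : p ≠ 0 := by linarith
    rcases this with h | h <;> rw [h] <;> simp [p0]
  have hmem : InNehari N hN ℓ n hℓ V β p (uB N ℓ n w R t) := by
    refine ⟨fun i => ?_, uB_pin N ℓ n hN hℓ hn wr R t, fun i => ⟨?_, ?_⟩⟩
    · rw [uB_eq]
      exact memH1_smooth (bsum_smooth n ws _ t) (bsum_supp hs (R := R) (fun j => (hpn _).le) t)
    · intro h0
      have := hpow i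
      rw [h0] at this
      have p0 : 2 * p ≠ 0 := by linarith
      simp only [Pi.zero_apply, abs_zero, Real.zero_rpow p0, integral_zero] at this
      have : 0 < n * (t ^ (2 * p) * B) := by positivity
      linarith
    · rw [Finset.sum_eq_zero, hnorm, hpow, t2p]
      · ring
      · intro j hj
        exact hint i j (Finset.ne_of_mem_erase hj)
  have := csInf_le (bdd_nehari hN hp hβ hV0) ⟨_, hmem, rfl⟩
  rw [energy_nehari hN hp hmem (Finset.sum_eq_zero fun i _ => Finset.sum_eq_zero fun j hj =>
    hint i j (Finset.ne_of_mem_erase hj))] at this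
  simp_rw [hnorm] at this
  rw [t2] at this
  unfold cPhi
  refine this.trans (le_of_eq ?_)
  simp
  ring

lemma int_pos_of {N : ℕ} {f : E N → ℝ} (hc : Continuous f) (hi : Integrable f) (h0 : ∀ x, 0 ≤ f x)
    {x : E N} (hx : f x ≠ 0) : 0 < ∫ x, f x :=
  integral_pos_of_integrable_nonneg_nonzero hc hi h0 hx

lemma normInf_eq {N : ℕ} {v : ℝ} {ω : E N → ℝ} (h : MemH1 N ω) :
    normVSq N (fun _ => v) ω = (∫ x, ‖gradient ω x‖ ^ 2) + v * ∫ x, ω x ^ 2 := by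
  unfold normVSq
  rw [integral_add (sq_int_grad h.2.2) (h.2.1.integrable_sq.const_mul v), integral_const_mul]

lemma sq_pos_of {N : ℕ} {ω : E N → ℝ} (h : MemH1 N ω) (h0 : ω ≠ 0) : 0 < ∫ x, ω x ^ 2 := by
  obtain ⟨x, hx⟩ := Function.ne_iff.1 h0
  exact int_pos_of (h.1.continuous.pow 2) h.2.1.integrable_sq (fun x => sq_nonneg _)
    (x := x) (pow_ne_zero 2 hx)

/-- the comparison for one small parameter -/
lemma cPhi_approx {N ℓ n : ℕ} (hN : 2 ≤ N) (hℓ : 0 < ℓ) (hn : 0 < n) {p β : ℝ} (hp : 1 < p) (hβ : β < 0)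
    {V : E N → ℝ} {Vinf : ℝ} (hV : Continuous V) (hVr : Radial N V) (hV2 : HypV2 N V Vinf)
    {ω : E N → ℝ} (hω : MemH1 N ω) (hi : Integrable fun x => |ω x| ^ (2 * p)) {A s : ℝ}
    (hA1 : normVSq N (fun _ => Vinf) ω = A) (hA2 : ∫ x, |ω x| ^ (2 * p) = A) (hs : 0 < s) (hsA : s < A) :
    cPhi N hN ℓ n hℓ V β p ≤ (ℓ : ℝ) * n * ((p - 1) / (2 * p) *
      (((A + s) / (A - s)) ^ (1 / (p - 1)) * (A + s))) := by
  obtain ⟨⟨c, c0, hc⟩, hv, hlim⟩ := hV2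
  set ε := min s (s / (2 * (1 + Vinf))) with hε
  have ε0 : 0 < ε := lt_min hs (by positivity)
  have ε1 : ε ≤ s := min_le_left _ _
  have ε2 : (1 + Vinf) * ε ≤ s / 2 := by
    have : ε ≤ s / (2 * (1 + Vinf)) := min_le_right _ _
    rw [le_div_iff₀ (by positivity)] at this
    linarith
  obtain ⟨w, ws, w0, wr, ⟨ρ, ρ0, wsup⟩, hg, h2, hB⟩ := radial_approx (by omega) (by linarith) hω hi ε0
  set B := ∫ x, |w x| ^ (2 * p) with hBd
  have hB1 : A - s < B := by rw [hA2] at hB; linarith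
  have hB0 : 0 < B := by linarith
  have hw1 : MemH1 N w := memH1_smooth ws wsup
  have hwne : w ≠ 0 := by
    intro h
    rw [hBd, h] at hB0
    simp [show p ≠ 0 by linarith] at hB0
  have w2 : 0 < ∫ x, w x ^ 2 := sq_pos_of hw1 hwne
  have hAw : (∫ x, ‖gradient w x‖ ^ 2) + Vinf * ∫ x, w x ^ 2 ≤ A + s / 2 := by
    rw [normInf_eq hω] at hA1
    nlinarith
  set δ := s / 2 / ∫ x, w x ^ 2 with hδ
  have δ0 : 0 < δ := by positivity
  have hev : ∀ᶠ x in cocompact (E N), V x < Vinf + δ := hlim.eventually (gt_mem_nhds (by linarith))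
  obtain ⟨M, hM⟩ : ∃ M : ℝ, ∀ x : E N, M ≤ ‖x‖ → V x ≤ Vinf + δ := by
    rw [← Metric.cobounded_eq_cocompact, ← comap_norm_atTop, eventually_comap] at hev
    obtain ⟨M, hM⟩ := eventually_atTop.1 hev
    exact ⟨M, fun x hx => (hM _ hx x rfl).le⟩
  obtain ⟨R, hR, hR0, hRM⟩ := ((exists_sep N ℓ n hN hℓ hn ρ).and
    ((eventually_ge_atTop 0).and (eventually_ge_atTop (M + ρ)))).exists
  have hRn : ‖R • Pt N 0‖ = R := by
    rw [norm_smul, Pt_norm N hN, Real.norm_eq_abs, abs_of_nonneg hR0, mul_one]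
  have wc := ws.continuous
  have i2 : Integrable fun x => w x ^ 2 := hw1.2.1.integrable_sq
  have iV : Integrable fun y => V (y + R • Pt N 0) * w y ^ 2 :=
    integrable_of_ball (by fun_prop) (R := ρ) fun x hx => by rw [wsup x hx]; ring
  have eA : AV V w (R • Pt N 0) = (∫ x, ‖gradient w x‖ ^ 2) + ∫ y, V (y + R • Pt N 0) * w y ^ 2 := by
    unfold AV
    exact integral_add (grad_sq_int_smooth ws wsup) iV
  have hAle : AV V w (R • Pt N 0) ≤ A + s := by
    have : ∫ y, V (y + R • Pt N 0) * w y ^ 2 ≤ ∫ y, (Vinf + δ) * w y ^ 2 := by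
      apply integral_mono iV (i2.const_mul _)
      intro y
      by_cases hy : ρ < ‖y‖
      · simp [wsup y hy]
      · apply mul_le_mul_of_nonneg_right _ (sq_nonneg _)
        apply hM
        push Not at hy
        have := norm_sub_le (y + R • Pt N 0) y
        rw [add_sub_cancel_left, hRn] at this
        linarith
    rw [integral_const_mul] at this
    have e : δ * ∫ x, w x ^ 2 = s / 2 := by rw [hδ]; field_simp
    rw [eA]
    linarith
  have hApos : 0 < AV V w (R • Pt N 0) := by
    have : ∫ y, c * w y ^ 2 ≤ ∫ y, V (y + R • Pt N 0) * w y ^ 2 := by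
      apply integral_mono (i2.const_mul _) iV
      intro y
      exact mul_le_mul_of_nonneg_right (hc _) (sq_nonneg _)
    rw [integral_const_mul] at this
    have h3 : 0 ≤ ∫ x, ‖gradient w x‖ ^ 2 := integral_nonneg fun x => sq_nonneg _
    have := mul_pos c0 w2
    linarith
  refine (nehari_bump hN hℓ hn hp hβ hV hVr (fun x => c0.le.trans (hc x)) ws wr wsup hB0 hR0 hR rfl hApos).trans ?_
  have p1 : 0 ≤ (p - 1) / (2 * p) := by apply div_nonneg <;> linarith
  have p2 : 0 ≤ 1 / (p - 1) := by apply div_nonneg <;> linarith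
  have hAs : 0 < A - s := by linarith
  have hAs2 : 0 < A + s := by linarith
  have hq : 0 ≤ ((A + s) / (A - s)) ^ (1 / (p - 1)) := by positivity
  gcongr

lemma cPhi_le_J {N ℓ n : ℕ} (hN : 2 ≤ N) (hℓ : 0 < ℓ) (hn : 0 < n) {p β : ℝ} (hp : 1 < p) (hβ : β < 0)
    {V : E N → ℝ} {Vinf : ℝ} (hV : Continuous V) (hVr : Radial N V) (hV2 : HypV2 N V Vinf)
    {ω : E N → ℝ} (hω : MemH1 N ω) (h0 : ω ≠ 0)
    (hA : normVSq N (fun _ => Vinf) ω = ∫ x, |ω x| ^ (2 * p)) :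
    cPhi N hN ℓ n hℓ V β p ≤ (ℓ : ℝ) * n * Jfun N (fun _ => Vinf) p ω := by
  set A := ∫ x, |ω x| ^ (2 * p) with hAd
  have hA0 : 0 < A := by
    rw [← hA, normInf_eq hω]
    have := mul_pos hV2.2.1 (sq_pos_of hω h0)
    have h3 : 0 ≤ ∫ x, ‖gradient ω x‖ ^ 2 := integral_nonneg fun x => sq_nonneg _
    linarith
  have hi : Integrable fun x => |ω x| ^ (2 * p) := by
    by_contra h
    rw [hAd, integral_undef h] at hA0
    exact lt_irrefl _ hA0
  have hJ : Jfun N (fun _ => Vinf) p ω = (p - 1) / (2 * p) * A := by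
    unfold Jfun
    rw [hA, ← hAd]
    have : p ≠ 0 := by linarith
    field_simp
  rw [hJ]
  have hT : Tendsto (fun s : ℝ => (ℓ : ℝ) * n * ((p - 1) / (2 * p) *
      (((A + s) / (A - s)) ^ (1 / (p - 1)) * (A + s)))) (𝓝[>] 0) (𝓝 ((ℓ : ℝ) * n * ((p - 1) / (2 * p) * A))) := by
    have hc : ContinuousAt (fun s : ℝ => (ℓ : ℝ) * n * ((p - 1) / (2 * p) *
      (((A + s) / (A - s)) ^ (1 / (p - 1)) * (A + s)))) 0 := by
      have h1 : ContinuousAt (fun s : ℝ => (A + s) / (A - s)) 0 :=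
        ContinuousAt.div (by fun_prop) (by fun_prop) (by simpa using hA0.ne')
      have h2 := h1.rpow_const (p := 1 / (p - 1)) (Or.inl (by simp [hA0.ne']))
      exact continuousAt_const.mul (continuousAt_const.mul (h2.mul (by fun_prop)))
    have := hc.tendsto
    simp only [add_zero, sub_zero, div_self hA0.ne', Real.one_rpow, one_mul] at this
    exact this.mono_left nhdsWithin_le_nhds
  refine ge_of_tendsto hT ?_
  filter_upwards [Ioo_mem_nhdsGT hA0] with s hs
  exact cPhi_approx hN hℓ hn hp hβ hV hVr hV2 hω hi hA rfl hs.1 hs.2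

lemma nehari_inf_nonempty {N : ℕ} {p Vinf : ℝ} (hp : 1 < p) (hv : 0 < Vinf) :
    ∃ u, MemH1 N u ∧ u ≠ 0 ∧ normVSq N (fun _ => Vinf) u = ∫ x, |u x| ^ (2 * p) := by
  set w : E N → ℝ := chi with hw
  have ws : ContDiff ℝ (⊤ : ℕ∞) w := chi_smooth
  have wsup : ∀ x, 2 < ‖x‖ → w x = 0 := chi_supp
  have wc := ws.continuous
  have w1 : MemH1 N w := memH1_smooth ws wsup
  have wne : w ≠ 0 := by
    intro h
    have : w 0 = 1 := chi_zero
    rw [h] at this; simp at this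
  have hsep : BSep (N := N) 1 (fun _ => 0) 2 := ⟨fun j hj k hk hjk => by omega⟩
  set A := AV (fun _ => Vinf) w (0 : E N) with hA
  set B := ∫ x, |w x| ^ (2 * p) with hB
  have hA0 : 0 < A := by
    have : A = normVSq N (fun _ => Vinf) w := rfl
    rw [this, normInf_eq w1]
    have := mul_pos hv (sq_pos_of w1 wne)
    have h3 : 0 ≤ ∫ x, ‖gradient w x‖ ^ 2 := integral_nonneg fun x => sq_nonneg _
    linarith
  have q0 : 0 < 2 * p := by linarith
  have cq : Continuous fun x => |w x| ^ (2 * p) := wc.abs.rpow_const fun _ => Or.inr q0.le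
  have hB0 : 0 < B := by
    refine int_pos_of cq (integrable_of_ball cq (R := 2) fun x hx => by
      rw [wsup x hx, abs_zero, Real.zero_rpow q0.ne']) (fun x => by positivity) (x := 0) ?_
    have : w 0 = 1 := chi_zero
    simp [this]
  set t : ℝ := (A / B) ^ (1 / (2 * (p - 1))) with ht
  have hAB : 0 < A / B := div_pos hA0 hB0
  have tp : 0 < t := Real.rpow_pos_of_pos hAB _
  have t2p : t ^ (2 * p) * B = t ^ 2 * A := by
    have e : t ^ (2 * p) = t ^ 2 * (A / B) := by
      have : 2 * p = (2 : ℕ) + 2 * (p - 1) := by push_cast; ring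
      rw [this, Real.rpow_add tp, Real.rpow_natCast]
      congr 1
      rw [ht, ← Real.rpow_mul hAB.le]
      have : 1 / (2 * (p - 1)) * (2 * (p - 1)) = 1 := by
        have : p - 1 ≠ 0 := by linarith
        field_simp
      rw [this, Real.rpow_one]
    rw [e]; field_simp
  refine ⟨bsum 1 w (fun _ => 0) t, memH1_smooth (bsum_smooth 1 ws _ t)
    (bsum_supp wsup (R := 0) (fun j => by simp) t), ?_, ?_⟩
  · intro h
    have h1 := congrFun h 0
    have : w 0 = 1 := chi_zero
    simp [bsum, this] at h1
    exact tp.ne' h1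
  · rw [bsum_norm continuous_const ws wsup hsep, bsum_pow wc q0 wsup hsep tp.le, t2p]
    simp [hA]

/-- **Proposition 3.1(e)**: `c^{φ_n} ≤ ℓ n 𝔠_∞`. -/
theorem statement12 (N ℓ n : ℕ) (hN : 4 ≤ N) (hℓ : 2 ≤ ℓ) (hn : 1 ≤ n)
    (p β : ℝ) (hp : 1 < p) (hp' : p < (N : ℝ) / ((N : ℝ) - 2)) (hβ : β < 0)
    (V : E N → ℝ) (Vinf : ℝ) (hVcont : Continuous V)
    (hV1 : Radial N V) (hV2 : HypV2 N V Vinf) :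
    cPhi N (by omega) ℓ n (by omega) V β p ≤ (ℓ : ℝ) * (n : ℝ) * cInfty N p Vinf := by
  have hln : (0 : ℝ) < (ℓ : ℝ) * n := by
    have : 0 < ℓ := by omega
    positivity
  rw [← div_le_iff₀' hln]
  unfold cInfty
  apply le_csInf
  · obtain ⟨u, hu⟩ := nehari_inf_nonempty (N := N) hp hV2.2.1
    exact ⟨_, u, hu, rfl⟩
  · rintro _ ⟨ω, ⟨h1, h2, h3⟩, rfl⟩
    rw [div_le_iff₀' hln]
    exact cPhi_le_J (by omega) (by omega) (by omega) hp hβ hVcont hV1 hV2 h1 h2 h3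
end
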